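/- Let M be the local dyadic maximal operator with respect to an open set Ω ⊆ ℝ^d and let E ⊆ ℝ^d have locally finite perimeter. Then Var_Ω(M1_E) ≤ C_d · H^{d-1}(∂*E ∩ Ω), where C_d depends only on d. In particular for Ω = ℝ^d, Var(M1_E) ≤ C_d · Var(1_E). -/

import Mathlib

open MeasureTheory Metric Set Filter
open scoped ENNReal

noncomputable def mClos {d : ℕ} (E : Set (EuclideanSpace ℝ (Fin d))) :
    Set (EuclideanSpace ℝ (Fin d)) :=
  {x | 0 < Filter.limsup
      (fun r : ℝ => volume (Metric.ball x r ∩ E) / ENNReal.ofReal (r ^ d))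
      (nhdsWithin 0 (Set.Ioi 0))}

noncomputable def mBdry {d : ℕ} (E : Set (EuclideanSpace ℝ (Fin d))) :
    Set (EuclideanSpace ℝ (Fin d)) :=
  mClos E ∩ mClos Eᶜ

noncomputable def divg {d : ℕ} (φ : EuclideanSpace ℝ (Fin d) → EuclideanSpace ℝ (Fin d))
    (x : EuclideanSpace ℝ (Fin d)) : ℝ :=
  ∑ i, fderiv ℝ φ x (EuclideanSpace.single i 1) i

noncomputable def var {d : ℕ} (Ω : Set (EuclideanSpace ℝ (Fin d)))
    (f : EuclideanSpace ℝ (Fin d) → ℝ) : ℝ≥0∞ :=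
  ⨆ (φ : EuclideanSpace ℝ (Fin d) → EuclideanSpace ℝ (Fin d)) (_ : ContDiff ℝ 1 φ)
    (_ : HasCompactSupport φ) (_ : tsupport φ ⊆ Ω) (_ : ∀ x, ‖φ x‖ ≤ 1),
    ENNReal.ofReal (∫ x in Ω, f x * divg φ x)

def HasLocFinitePerimeter {d : ℕ} (E : Set (EuclideanSpace ℝ (Fin d))) : Prop :=
  ∀ U : Set (EuclideanSpace ℝ (Fin d)), IsOpen U → Bornology.IsBounded U →
    var U (E.indicator fun _ => (1 : ℝ)) < ⊤

def dyadCube {d : ℕ} (n : ℤ) (k : Fin d → ℤ) : Set (EuclideanSpace ℝ (Fin d)) :=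
  {x | ∀ i, (k i : ℝ) * 2 ^ n ≤ x i ∧ x i < ((k i : ℝ) + 1) * 2 ^ n}

noncomputable def dyadMax {d : ℕ} (Ω E : Set (EuclideanSpace ℝ (Fin d)))
    (x : EuclideanSpace ℝ (Fin d)) : ℝ≥0∞ :=
  ⨆ (n : ℤ) (k : Fin d → ℤ) (_ : x ∈ dyadCube n k) (_ : dyadCube n k ⊆ Ω),
    volume (E ∩ dyadCube n k) / volume (dyadCube n k)

namespace DM
open scoped Topology

abbrev Sp (d : ℕ) := EuclideanSpace ℝ (Fin d)

structure Tst {d : ℕ} (U : Set (Sp d)) (φ : Sp d → Sp d) : Prop where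
  cd : ContDiff ℝ 1 φ
  cs : HasCompactSupport φ
  ts : tsupport φ ⊆ U

noncomputable def Per {d : ℕ} (E U : Set (Sp d)) : ℝ≥0∞ := var U (E.indicator fun _ => (1 : ℝ))

variable {d : ℕ}

lemma divg_zero_of_notMem {φ : Sp d → Sp d} {x : Sp d} (hx : x ∉ tsupport φ) : divg φ x = 0 := by
  have : fderiv ℝ φ x = 0 := by
    by_contra h
    exact hx (support_fderiv_subset ℝ h)
  simp [divg, this]

lemma continuous_divg {φ : Sp d → Sp d} (h : ContDiff ℝ 1 φ) : Continuous (divg φ) := by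
  unfold divg
  refine continuous_finsetSum _ fun i _ => ?_
  have h1 : Continuous (fun x => fderiv ℝ φ x (EuclideanSpace.single i 1)) :=
    (h.continuous_fderiv one_ne_zero).clm_apply continuous_const
  exact (EuclideanSpace.proj (𝕜 := ℝ) i).continuous.comp h1

lemma divg_compact {φ : Sp d → Sp d} (h : HasCompactSupport φ) : HasCompactSupport (divg φ) :=
  h.of_isClosed_subset (isClosed_tsupport _) (closure_minimal (fun x hx => by
    by_contra h'
    exact hx (divg_zero_of_notMem h')) (isClosed_tsupport _))

lemma integrable_divg {φ : Sp d → Sp d} (h : ContDiff ℝ 1 φ) (hc : HasCompactSupport φ) :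
    Integrable (divg φ) :=
  (continuous_divg h).integrable_of_hasCompactSupport (divg_compact hc)

lemma divg_bound {φ : Sp d → Sp d} (h : ContDiff ℝ 1 φ) (hc : HasCompactSupport φ) :
    ∃ M, 0 ≤ M ∧ ∀ x, |divg φ x| ≤ M := by
  obtain ⟨C, hC⟩ := (divg_compact hc).exists_bound_of_continuous (continuous_divg h)
  exact ⟨C, (norm_nonneg _).trans (hC 0), hC⟩

lemma divg_smul {χ : Sp d → ℝ} {φ : Sp d → Sp d} {x : Sp d} (h1 : DifferentiableAt ℝ χ x)
    (h2 : DifferentiableAt ℝ φ x) :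
    divg (fun x => χ x • φ x) x = χ x * divg φ x + fderiv ℝ χ x (φ x) := by
  have e : φ x = ∑ i, (φ x i) • EuclideanSpace.single i (1 : ℝ) := by
    ext j
    simp [Pi.single_apply]
  have : fderiv ℝ χ x (φ x) = ∑ i, φ x i * fderiv ℝ χ x (EuclideanSpace.single i (1 : ℝ)) := by
    conv_lhs => rw [e]
    simp
  rw [this]
  unfold divg
  rw [fderiv_fun_smul h1 h2, Finset.mul_sum, ← Finset.sum_add_distrib]
  refine Finset.sum_congr rfl fun i _ => ?_
  simp
  ring

lemma divg_const_smul {c : ℝ} {φ : Sp d → Sp d} {x : Sp d} (h2 : DifferentiableAt ℝ φ x) :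
    divg (fun x => c • φ x) x = c * divg φ x := by
  rw [divg_smul (differentiableAt_const c) h2]; simp

lemma divg_add {φ ψ : Sp d → Sp d} {x : Sp d} (h1 : DifferentiableAt ℝ φ x)
    (h2 : DifferentiableAt ℝ ψ x) :
    divg (fun x => φ x + ψ x) x = divg φ x + divg ψ x := by
  unfold divg
  rw [fderiv_fun_add h1 h2, ← Finset.sum_add_distrib]
  simp

lemma integral_divg {φ : Sp d → Sp d} (h : ContDiff ℝ 1 φ) (hc : HasCompactSupport φ) :
    ∫ x, divg φ x = 0 := by
  unfold divg
  have key : ∀ i : Fin d, ∀ x, fderiv ℝ φ x (EuclideanSpace.single i 1) i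
      = fderiv ℝ (fun y => φ y i) x (EuclideanSpace.single i 1) := by
    intro i x
    have := ((EuclideanSpace.proj (𝕜 := ℝ) i).hasFDerivAt.comp x
      (h.differentiable one_ne_zero x).hasFDerivAt).fderiv
    change _ = fderiv ℝ (⇑(EuclideanSpace.proj (𝕜 := ℝ) i) ∘ φ) x _
    rw [this]
    rfl
  have hci : ∀ i : Fin d, ContDiff ℝ 1 (fun y => φ y i) := fun i =>
    (EuclideanSpace.proj (𝕜 := ℝ) i).contDiff.comp h
  have hcs : ∀ i : Fin d, HasCompactSupport (fun y => φ y i) := fun i =>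
    hc.comp_left (g := fun v : Sp d => v i) rfl
  have hI : ∀ i : Fin d, Integrable
      (fun x => fderiv ℝ (fun y => φ y i) x (EuclideanSpace.single i 1)) := fun i =>
    (((hci i).continuous_fderiv one_ne_zero).clm_apply
      continuous_const).integrable_of_hasCompactSupport
      ((hcs i).fderiv_apply (𝕜 := ℝ) _)
  simp_rw [key]
  rw [integral_finsetSum _ (fun i _ => hI i)]
  refine Finset.sum_eq_zero fun i _ => ?_
  have := integral_mul_fderiv_eq_neg_fderiv_mul_of_integrable (μ := (volume : Measure (Sp d)))
    (f := fun _ => (1 : ℝ)) (g := fun y => φ y i) (v := EuclideanSpace.single i (1 : ℝ))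
    (by simp) (by simpa using hI i)
    (by simpa using (hci i).continuous.integrable_of_hasCompactSupport (hcs i))
    (fun x _ => differentiableAt_const _) (fun x _ => (hci i).differentiable one_ne_zero x)
  simpa using this

lemma setInt_eq {E U : Set (Sp d)} (hE : MeasurableSet E) {φ : Sp d → Sp d} (h : tsupport φ ⊆ U) :
    ∫ x in U, (E.indicator fun _ => (1 : ℝ)) x * divg φ x = ∫ x in E, divg φ x := by
  rw [setIntegral_eq_integral_of_forall_compl_eq_zero, ← integral_indicator hE]
  · congr 1; ext x
    by_cases hx : x ∈ E <;> simp [hx]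
  · intro x hx
    rw [divg_zero_of_notMem (fun h' => hx (h h')), mul_zero]

lemma le_Per {E U : Set (Sp d)} (hE : MeasurableSet E) {φ : Sp d → Sp d} (h : Tst U φ)
    (hn : ∀ x, ‖φ x‖ ≤ 1) : ENNReal.ofReal (∫ x in E, divg φ x) ≤ Per E U := by
  unfold Per var
  rw [← setInt_eq hE h.ts]
  exact le_iSup_of_le φ (le_iSup_of_le h.cd (le_iSup_of_le h.cs (le_iSup_of_le h.ts
    (le_iSup_of_le hn le_rfl))))

lemma Per_le {E U : Set (Sp d)} (hE : MeasurableSet E) {b : ℝ≥0∞}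
    (H : ∀ φ : Sp d → Sp d, Tst U φ → (∀ x, ‖φ x‖ ≤ 1) →
      ENNReal.ofReal (∫ x in E, divg φ x) ≤ b) : Per E U ≤ b := by
  unfold Per var
  refine iSup_le fun φ => iSup_le fun h1 => iSup_le fun h2 => iSup_le fun h3 => iSup_le fun h4 => ?_
  rw [setInt_eq hE h3]
  exact H φ ⟨h1, h2, h3⟩ h4

lemma Tst.mono {U V : Set (Sp d)} {φ : Sp d → Sp d} (h : Tst U φ) (hUV : U ⊆ V) : Tst V φ :=
  ⟨h.cd, h.cs, h.ts.trans hUV⟩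

lemma Per_mono {E U V : Set (Sp d)} (hE : MeasurableSet E) (h : U ⊆ V) : Per E U ≤ Per E V :=
  Per_le hE fun _ hφ hn => le_Per hE (hφ.mono h) hn

lemma Tst.const_smul {U : Set (Sp d)} {φ : Sp d → Sp d} (h : Tst U φ) (c : ℝ) :
    Tst U (fun x => c • φ x) :=
  ⟨h.cd.const_smul c, h.cs.comp_left (g := fun v => c • v) (smul_zero c),
    (closure_mono (Function.support_const_smul_subset c φ)).trans h.ts⟩

lemma Tst.smul {U : Set (Sp d)} {φ : Sp d → Sp d} (h : Tst U φ) {χ : Sp d → ℝ}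
    (hχ : ContDiff ℝ 1 χ) : Tst U (fun x => χ x • φ x) :=
  ⟨hχ.smul h.cd, h.cs.smul_left (f := χ),
    (closure_mono (Function.support_smul_subset_right χ φ)).trans h.ts⟩

lemma Tst.add {U : Set (Sp d)} {φ ψ : Sp d → Sp d} (h : Tst U φ) (h' : Tst U ψ) :
    Tst U (fun x => φ x + ψ x) :=
  ⟨h.cd.add h'.cd, h.cs.add h'.cs,
    (tsupport_add φ ψ).trans (union_subset h.ts h'.ts)⟩

lemma int_le_Per {E U : Set (Sp d)} (hE : MeasurableSet E) (hP : Per E U ≠ ⊤)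
    {φ : Sp d → Sp d} (h : Tst U φ) {M : ℝ} (hM : 0 ≤ M)
    (hn : ∀ x, ‖φ x‖ ≤ M) : ∫ x in E, divg φ x ≤ M * (Per E U).toReal := by
  rcases hM.eq_or_lt with rfl | hM
  · have : φ = fun _ => 0 := by
      ext1 x; simpa using hn x
    have h0 : ∀ x, divg φ x = 0 := by
      intro x; subst this; simp [divg]
    simp [h0]
  have h1 := le_Per hE (h.const_smul M⁻¹) (by
    intro x; rw [norm_smul, norm_inv, Real.norm_of_nonneg hM.le]
    rw [inv_mul_le_iff₀ hM]; simpa using hn x)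
  rw [show (fun x => divg (fun x => M⁻¹ • φ x) x) = fun x => M⁻¹ * divg φ x from
    funext fun x => divg_const_smul (h.cd.differentiable one_ne_zero x),
    integral_const_mul] at h1
  rw [ENNReal.ofReal_le_iff_le_toReal hP, inv_mul_le_iff₀ hM] at h1
  exact h1

lemma abs_int_le_Per {E U : Set (Sp d)} (hE : MeasurableSet E) (hP : Per E U ≠ ⊤)
    {φ : Sp d → Sp d} (h : Tst U φ) {M : ℝ} (hM : 0 ≤ M)
    (hn : ∀ x, ‖φ x‖ ≤ M) : |∫ x in E, divg φ x| ≤ M * (Per E U).toReal := by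
  refine abs_le.2 ⟨?_, int_le_Per hE hP h hM hn⟩
  have := int_le_Per hE hP (h.const_smul (-1)) hM (by simpa using hn)
  rw [show (fun x => divg (fun x => (-1 : ℝ) • φ x) x) = fun x => (-1) * divg φ x from
    funext fun x => divg_const_smul (h.cd.differentiable one_ne_zero x),
    integral_const_mul] at this
  linarith

lemma Per_add_le {E U V : Set (Sp d)} (hE : MeasurableSet E) (hUV : Disjoint U V) :
    Per E U + Per E V ≤ Per E (U ∪ V) := by
  have key : ∀ φ : Sp d → Sp d, Tst U φ → (∀ x, ‖φ x‖ ≤ 1) → ∀ ψ : Sp d → Sp d, Tst V ψ →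
      (∀ x, ‖ψ x‖ ≤ 1) → ENNReal.ofReal (∫ x in E, divg φ x) + ENNReal.ofReal (∫ x in E, divg ψ x)
      ≤ Per E (U ∪ V) := by
    intro φ hφ hφn ψ hψ hψn
    have h1 := le_Per hE (hφ.mono subset_union_left) hφn (U := U ∪ V)
    have h2 := le_Per hE (hψ.mono subset_union_right) hψn (U := U ∪ V)
    rcases le_total (∫ x in E, divg φ x) 0 with h0 | h0
    · rw [ENNReal.ofReal_of_nonpos h0, zero_add]; exact h2
    rcases le_total (∫ x in E, divg ψ x) 0 with h0' | h0'
    · rw [ENNReal.ofReal_of_nonpos h0', add_zero]; exact h1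
    rw [← ENNReal.ofReal_add h0 h0', ← integral_add (integrable_divg hφ.cd hφ.cs).integrableOn
      (integrable_divg hψ.cd hψ.cs).integrableOn]
    have := le_Per hE ((hφ.mono subset_union_left).add (hψ.mono subset_union_right)) (U := U ∪ V) (by
      intro x
      by_cases hx : x ∈ tsupport φ
      · have : ψ x = 0 := image_eq_zero_of_notMem_tsupport fun h =>
          (disjoint_left.1 hUV (hφ.ts hx) (hψ.ts h))
        simpa [this] using hφn x
      · simpa [image_eq_zero_of_notMem_tsupport hx] using hψn x)
    convert this using 3
    ext x
    exact (divg_add (hφ.cd.differentiable one_ne_zero x) (hψ.cd.differentiable one_ne_zero x)).symm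
  by_cases hT : Per E (U ∪ V) = ⊤
  · rw [hT]; exact le_top
  have hV : Per E V ≠ ⊤ := ne_top_of_le_ne_top hT (Per_mono hE subset_union_right)
  refine add_le_of_le_tsub_right_of_le (Per_mono hE subset_union_right) ?_
  refine Per_le hE fun φ hφ hφn => ?_
  have hle : ENNReal.ofReal (∫ x in E, divg φ x) ≤ Per E (U ∪ V) :=
    le_Per hE (hφ.mono subset_union_left) hφn
  refine ENNReal.le_sub_of_add_le_right hV ?_
  rw [add_comm]
  refine add_le_of_le_tsub_right_of_le hle ?_
  refine Per_le hE fun ψ hψ hψn => ?_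
  refine ENNReal.le_sub_of_add_le_right ENNReal.ofReal_ne_top ?_
  rw [add_comm]
  exact key φ hφ hφn ψ hψ hψn

lemma sum_Per_le {E U : Set (Sp d)} (hE : MeasurableSet E) {ι : Type*} (s : Finset ι)
    (V : ι → Set (Sp d)) (hV : ∀ i ∈ s, V i ⊆ U)
    (hd : (s : Set ι).PairwiseDisjoint V) : ∑ i ∈ s, Per E (V i) ≤ Per E U := by
  classical
  refine le_trans ?_ (Per_mono hE (iUnion₂_subset hV))
  clear hV
  induction s using Finset.induction_on with
  | empty => simp
  | insert a s ha ih =>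
    rw [Finset.sum_insert ha, Finset.set_biUnion_insert]
    refine le_trans (add_le_add_right (ih (hd.subset (by simp))) _) (Per_add_le hE ?_)
    rw [disjoint_iUnion₂_right]
    intro i hi
    exact hd (by simp) (by simp [hi]) (by rintro rfl; exact ha hi)

lemma sum_Per_le_real {E U : Set (Sp d)} (hE : MeasurableSet E) {ι : Type*} (s : Finset ι)
    (hP : Per E U ≠ ⊤)
    (V : ι → Set (Sp d)) (hV : ∀ i ∈ s, V i ⊆ U)
    (hd : (s : Set ι).PairwiseDisjoint V) :
    ∑ i ∈ s, (Per E (V i)).toReal ≤ (Per E U).toReal := by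
  rw [← ENNReal.toReal_sum]
  · exact ENNReal.toReal_mono hP (sum_Per_le hE s V hV hd)
  · intro i hi
    exact ne_top_of_le_ne_top hP (Per_mono hE (hV i hi))

lemma Per_compl {E U : Set (Sp d)} (hE : MeasurableSet E) : Per Eᶜ U = Per E U := by
  have : ∀ E : Set (Sp d), MeasurableSet E → Per Eᶜ U ≤ Per E U := by
    intro E hE
    refine Per_le hE.compl fun φ hφ hn => ?_
    have h1 := integral_add_compl hE (integrable_divg hφ.cd hφ.cs)
    rw [integral_divg hφ.cd hφ.cs] at h1
    have h2 := le_Per hE (hφ.const_smul (-1)) (by simpa using hn)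
    rw [show (fun x => divg (fun x => (-1 : ℝ) • φ x) x) = fun x => (-1) * divg φ x from
      funext fun x => divg_const_smul (hφ.cd.differentiable one_ne_zero x),
      integral_const_mul] at h2
    convert h2 using 2
    linarith
  refine le_antisymm (this E hE) ?_
  simpa using this Eᶜ hE.compl

/-- smooth cutoff -/
lemma exists_cutoff {K U : Set (Sp d)} (hK : IsCompact K) (hU : IsOpen U) (hKU : K ⊆ U) :
    ∃ ψ : Sp d → ℝ, ContDiff ℝ 1 ψ ∧ HasCompactSupport ψ ∧ tsupport ψ ⊆ U ∧
      (∀ x ∈ K, ψ x = 1) ∧ ∀ x, ψ x ∈ Icc (0 : ℝ) 1 := by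
  obtain ⟨W, hWo, hKW, hWU, hWc⟩ := exists_open_between_and_isCompact_closure hK hU hKU
  obtain ⟨f, h0, h1, h2⟩ := exists_contMDiffMap_zero_one_of_isClosed (n := 1)
    (modelWithCornersSelf ℝ (Sp d)) hWo.isClosed_compl hK.isClosed
    (disjoint_compl_left_iff_subset.2 hKW)
  have hs : tsupport f ⊆ closure W := closure_mono fun x hx => by
    by_contra h
    exact hx (h0 h)
  refine ⟨f, f.contMDiff.contDiff, hWc.of_isClosed_subset (isClosed_tsupport _) hs, hs.trans hWU, fun x hx => h1 hx, h2⟩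

end DM

namespace DM
open scoped Topology
variable {d : ℕ}

lemma trans_le {E U : Set (Sp d)} (hE : MeasurableSet E) (hP : Per E U ≠ ⊤)
    {ψ : Sp d → ℝ} (h1 : ContDiff ℝ 1 ψ) (h2 : HasCompactSupport ψ) (h3 : ∀ x, |ψ x| ≤ 1)
    (h : Sp d) (hs : ∀ t ∈ Icc (0:ℝ) 1, ∀ x, x - t • h ∈ tsupport ψ → x ∈ U) :
    |(∫ x in E, ψ (x - h)) - ∫ x in E, ψ x| ≤ ‖h‖ * (Per E U).toReal := by
  have hdiff : Differentiable ℝ ψ := h1.differentiable one_ne_zero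
  obtain ⟨C, hC⟩ := (h2.fderiv (𝕜 := ℝ)).exists_bound_of_continuous
    (h1.continuous_fderiv one_ne_zero)
  have hC0 : 0 ≤ C := (norm_nonneg _).trans (hC 0)
  obtain ⟨R, hR⟩ := h2.isBounded.subset_closedBall (0 : Sp d)
  set F : ℝ → ℝ := fun s => ∫ x in E, ψ (x - s • h) with hF
  have hcomp : ∀ s : ℝ, HasCompactSupport (fun x => ψ (x - s • h)) := fun s =>
    h2.comp_homeomorph (Homeomorph.subRight (s • h))
  have hder : ∀ s : ℝ, HasDerivAt F (∫ x in E, -(fderiv ℝ ψ (x - s • h) h)) s := by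
    intro s0
    refine (hasDerivAt_integral_of_dominated_loc_of_deriv_le (s := ball s0 1)
      (F := fun s x => ψ (x - s • h)) (F' := fun s x => -(fderiv ℝ ψ (x - s • h) h))
      (bound := (closedBall (0 : Sp d) (R + (|s0| + 1) * ‖h‖)).indicator fun _ => C * ‖h‖)
      (ball_mem_nhds s0 one_pos) ?_ ?_ ?_ ?_ ?_ ?_).2
    · refine Eventually.of_forall fun s => ?_
      exact (h1.continuous.comp (continuous_id.sub continuous_const)).aestronglyMeasurable
    · exact ((h1.continuous.comp (continuous_id.sub
        continuous_const)).integrable_of_hasCompactSupport (hcomp s0)).integrableOn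
    · have : Continuous fun x => -(fderiv ℝ ψ (x - s0 • h) h) :=
        (((h1.continuous_fderiv one_ne_zero).comp (continuous_id.sub
          continuous_const)).clm_apply continuous_const).neg
      exact this.aestronglyMeasurable
    · refine Eventually.of_forall fun x s hs' => ?_
      rw [norm_neg]
      by_cases hx : x ∈ closedBall (0 : Sp d) (R + (|s0| + 1) * ‖h‖)
      · rw [indicator_of_mem hx]
        exact (ContinuousLinearMap.le_opNorm _ _).trans
          (mul_le_mul_of_nonneg_right (hC _) (norm_nonneg _))
      · rw [indicator_of_notMem hx]
        have : fderiv ℝ ψ (x - s • h) = 0 := by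
          by_contra h'
          have h4 := hR (support_fderiv_subset ℝ (f := ψ) h')
          rw [mem_closedBall_zero_iff] at h4 hx
          apply hx
          have h5 : ‖x‖ ≤ ‖x - s • h‖ + ‖s • h‖ := by
            simpa using norm_add_le (x - s • h) (s • h)
          rw [norm_smul, Real.norm_eq_abs] at h5
          rw [mem_ball, Real.dist_eq] at hs'
          have h6 : |s| ≤ |s0| + 1 := by
            have := abs_add_le (s - s0) s0
            simp at this; linarith
          have := mul_le_mul_of_nonneg_right h6 (norm_nonneg h)
          linarith
        simp [this]
    · have : IntegrableOn (fun _ : Sp d => C * ‖h‖)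
          (closedBall (0 : Sp d) (R + (|s0| + 1) * ‖h‖)) :=
        integrableOn_const (measure_closedBall_lt_top.ne)
      exact ((integrable_indicator_iff measurableSet_closedBall).2 this).integrableOn
    · refine Eventually.of_forall fun x s _ => ?_
      have e1 : HasDerivAt (fun s : ℝ => x - s • h) (-h) s := by
        simpa using ((hasDerivAt_id s).smul_const h).const_sub x
      have := (hdiff (x - s • h)).hasFDerivAt.comp_hasDerivAt s e1
      simpa [Function.comp_def] using this
  have hb : ∀ s ∈ Icc (0:ℝ) 1, ‖∫ x in E, -(fderiv ℝ ψ (x - s • h) h)‖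
      ≤ ‖h‖ * (Per E U).toReal := by
    intro s hs'
    rw [integral_neg, norm_neg, Real.norm_eq_abs]
    have hcd : ContDiff ℝ 1 (fun x => ψ (x - s • h)) := h1.comp (contDiff_id.sub contDiff_const)
    have hT : Tst U (fun x => ψ (x - s • h) • h) := by
      refine ⟨hcd.smul contDiff_const, (hcomp s).smul_right (f' := fun _ => h), ?_⟩
      intro x hx
      refine hs s hs' x ?_
      have h7 : tsupport (fun x => ψ (x - s • h) • h) ⊆ (fun x => x - s • h) ⁻¹' tsupport ψ := by
        refine closure_minimal ?_ ((isClosed_tsupport ψ).preimage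
          (continuous_id.sub continuous_const))
        intro y hy
        refine subset_tsupport _ ?_
        intro h0
        exact hy (by simp [h0])
      exact h7 hx
    have := abs_int_le_Per hE hP hT (norm_nonneg h) (by
      intro x
      rw [norm_smul]
      exact mul_le_of_le_one_left (norm_nonneg _) (h3 _))
    convert this using 3
    ext x
    rw [divg_smul (hcd.differentiable one_ne_zero x) (differentiableAt_const h)]
    rw [fderiv_comp_sub]
    simp [divg]
  have := Convex.norm_image_sub_le_of_norm_hasDerivWithin_le (f := F)
    (f' := fun s => ∫ x in E, -(fderiv ℝ ψ (x - s • h) h)) (s := Icc (0:ℝ) 1) (x := 0) (y := 1)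
    (fun s _ => (hder s).hasDerivWithinAt) hb (convex_Icc 0 1) (by simp) (by simp)
  simpa [hF] using this

lemma trans_set {E U : Set (Sp d)} (hE : MeasurableSet E) (hU : IsOpen U) (hc : Convex ℝ U)
    (hfin : volume U ≠ ⊤) (hP : Per E U ≠ ⊤) (h : Sp d) :
    volume.real {x | x ∈ U ∧ x + h ∈ U ∧ x ∈ E ∧ x + h ∉ E} ≤ ‖h‖ * (Per E U).toReal := by
  set A : Set (Sp d) := {x | x ∈ U ∧ x + h ∈ U ∧ x ∈ E ∧ x + h ∉ E} with hA
  have hm : Measurable (fun x : Sp d => x + h) := measurable_id.add_const h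
  set V : Set (Sp d) := U ∩ (fun x => x + h) ⁻¹' U with hV
  have hVo : IsOpen V := hU.inter (hU.preimage (continuous_id.add continuous_const))
  have hAm : MeasurableSet A :=
    (hU.measurableSet.inter ((hm hU.measurableSet).inter (hE.inter (hm hE).compl)))
  have hAV : A ⊆ V := fun x hx => ⟨hx.1, hx.2.1⟩
  have hAfin : volume A ≠ ⊤ := ne_top_of_le_ne_top hfin (measure_mono fun x hx => hx.1)
  refine le_of_forall_pos_le_add fun ε hε => ?_
  have hε2 : ENNReal.ofReal (ε / 2) ≠ 0 := by simpa using hε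
  obtain ⟨K, hKA, hKc, hK⟩ := hAm.exists_isCompact_lt_add hAfin hε2
  have hKfin : volume K ≠ ⊤ := hKc.measure_lt_top.ne
  obtain ⟨W, hKW, hWo, hW⟩ := hKc.exists_isOpen_lt_add (μ := volume) hε2
  obtain ⟨ψ, p1, p2, p3, p4, p5⟩ := exists_cutoff hKc (hWo.inter hVo)
    (subset_inter hKW (hKA.trans hAV))
  have hWfin : volume W ≠ ⊤ := (hW.trans_le le_top).ne
  have key := trans_le hE hP p1 p2 (fun x => abs_le.2 ⟨by linarith [(p5 x).1], (p5 x).2⟩) h (by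
    intro t ht x hx
    have := (p3 hx).2
    have h8 := hc this.1 this.2 (sub_nonneg.2 ht.2) ht.1 (by ring)
    convert h8 using 1
    module)
  have hI : Integrable ψ := p1.continuous.integrable_of_hasCompactSupport p2
  have hEh : MeasurableSet {x | x + h ∈ E} := hm hE
  have e1 : ∫ x in E, ψ (x - h) = ∫ x in {x | x + h ∈ E}, ψ x := by
    rw [← integral_indicator hE, ← integral_indicator hEh,
      ← integral_add_right_eq_self _ h]
    congr 1; ext x
    by_cases hx : x + h ∈ E <;> simp [indicator, hx]
  have e2 : (∫ x in E, ψ x) - ∫ x in {x | x + h ∈ E}, ψ x =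
      ∫ x, (E.indicator ψ x - ({x | x + h ∈ E}).indicator ψ x) := by
    rw [integral_sub (hI.indicator hE) (hI.indicator hEh), integral_indicator hE,
      integral_indicator hEh]
  have e3 : volume.real K - volume.real (W \ K) ≤
      ∫ x, (E.indicator ψ x - ({x | x + h ∈ E}).indicator ψ x) := by
    have hWK : MeasurableSet (W \ K) := hWo.measurableSet.diff hKc.measurableSet
    have hWKfin : volume (W \ K) ≠ ⊤ := ne_top_of_le_ne_top hWfin (measure_mono sdiff_subset)
    have i1 : Integrable (K.indicator fun _ => (1:ℝ)) :=
      (integrable_indicator_iff hKc.measurableSet).2 (integrableOn_const hKfin)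
    have i2 : Integrable ((W \ K).indicator fun _ => (1:ℝ)) :=
      (integrable_indicator_iff hWK).2 (integrableOn_const hWKfin)
    have : volume.real K - volume.real (W \ K) =
        ∫ x, ((K.indicator fun _ => (1:ℝ)) x - ((W \ K).indicator fun _ => (1:ℝ)) x) := by
      rw [integral_sub i1 i2, integral_indicator hKc.measurableSet, integral_indicator hWK]
      simp
    rw [this]
    refine integral_mono (i1.sub i2) ((hI.indicator hE).sub (hI.indicator hEh)) fun x => ?_
    by_cases hxK : x ∈ K
    · have hxA := hKA hxK
      have q1 : x ∈ E := hxA.2.2.1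
      have q2 : x + h ∉ E := hxA.2.2.2
      simp [hxK, q1, q2, p4 x hxK]
    · by_cases hxW : x ∈ W
      · simp only [indicator, hxK, hxW, Set.mem_sdiff, not_false_eq_true, and_self, if_true, if_false]
        have := p5 x
        split_ifs <;> linarith [this.1, this.2]
      · have : ψ x = 0 := image_eq_zero_of_notMem_tsupport fun h' => hxW (p3 h').1
        simp [indicator, hxK, hxW, this]
  have e4 : volume.real (W \ K) ≤ ε / 2 := by
    rw [measureReal_sdiff hKW hKc.measurableSet hWfin, sub_le_iff_le_add, ← ENNReal.toReal_ofReal (by positivity : 0 ≤ ε/2)]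
    unfold Measure.real
    rw [add_comm, ← ENNReal.toReal_add hKfin ENNReal.ofReal_ne_top]
    exact ENNReal.toReal_mono (by finiteness) hW.le
  have e5 : volume.real A ≤ volume.real K + ε / 2 := by
    rw [← ENNReal.toReal_ofReal (by positivity : 0 ≤ ε/2)]
    unfold Measure.real
    rw [← ENNReal.toReal_add hKfin ENNReal.ofReal_ne_top]
    exact ENNReal.toReal_mono (by finiteness) hK.le
  rw [e1] at key
  have := (abs_le.1 key).1
  linarith

/-- relative isoperimetric (Poincare) inequality for convex sets -/
lemma poincare {E U : Set (Sp d)} (hE : MeasurableSet E) (hU : IsOpen U) (hc : Convex ℝ U)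
    (hfin : volume U ≠ ⊤) (hP : Per E U ≠ ⊤) {R : ℝ} (hR0 : 0 ≤ R)
    (hR : ∀ x ∈ U, ∀ y ∈ U, ‖y - x‖ ≤ R) :
    volume.real (E ∩ U) * volume.real (U \ E) ≤
      volume.real (closedBall (0 : Sp d) R) * (R * (Per E U).toReal) := by
  have hUm := hU.measurableSet
  have m1 : MeasurableSet (E ∩ U) := hE.inter hUm
  have m2 : MeasurableSet (U \ E) := hUm.diff hE
  have step : volume (E ∩ U) * volume (U \ E) ≤
      volume (closedBall (0 : Sp d) R) * ENNReal.ofReal (R * (Per E U).toReal) := by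
    have hmeas : Measurable (fun p : Sp d × Sp d =>
        (E ∩ U).indicator (1 : Sp d → ℝ≥0∞) p.1 * (U \ E).indicator (1 : Sp d → ℝ≥0∞) (p.1 + p.2)) :=
      ((measurable_one.indicator m1).comp measurable_fst).mul
        ((measurable_one.indicator m2).comp (measurable_fst.add measurable_snd))
    calc volume (E ∩ U) * volume (U \ E)
        = ∫⁻ x, (E ∩ U).indicator (1 : Sp d → ℝ≥0∞) x * volume (U \ E) := by
          rw [lintegral_mul_const _ (measurable_one.indicator m1), lintegral_indicator_one m1]
      _ = ∫⁻ x, ∫⁻ h, (E ∩ U).indicator (1 : Sp d → ℝ≥0∞) x *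
            (U \ E).indicator (1 : Sp d → ℝ≥0∞) (x + h) := by
          refine lintegral_congr fun x => ?_
          have hmm : Measurable fun h => (U \ E).indicator (1 : Sp d → ℝ≥0∞) (x + h) :=
            (measurable_one.indicator m2).comp (measurable_const_add x)
          rw [lintegral_const_mul _ hmm,
            lintegral_add_left_eq_self (fun y => (U \ E).indicator (1 : Sp d → ℝ≥0∞) y) x,
            lintegral_indicator_one m2]
      _ = ∫⁻ h, ∫⁻ x, (E ∩ U).indicator (1 : Sp d → ℝ≥0∞) x *
            (U \ E).indicator (1 : Sp d → ℝ≥0∞) (x + h) :=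
          lintegral_lintegral_swap hmeas.aemeasurable
      _ ≤ ∫⁻ h, (closedBall (0 : Sp d) R).indicator
            (fun _ => ENNReal.ofReal (R * (Per E U).toReal)) h := by
          refine lintegral_mono fun h => ?_
          have hle : ∫⁻ x, (E ∩ U).indicator (1 : Sp d → ℝ≥0∞) x *
              (U \ E).indicator (1 : Sp d → ℝ≥0∞) (x + h) =
              volume {x | x ∈ U ∧ x + h ∈ U ∧ x ∈ E ∧ x + h ∉ E} := by
            have hm : Measurable (fun x : Sp d => x + h) := measurable_id.add_const h
            have hmS : MeasurableSet {x | x ∈ U ∧ x + h ∈ U ∧ x ∈ E ∧ x + h ∉ E} :=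
              (hUm.inter ((hm hUm).inter (hE.inter (hm hE).compl)))
            rw [← lintegral_indicator_one hmS]
            refine lintegral_congr fun x => ?_
            by_cases a1 : x ∈ U <;> by_cases a2 : x + h ∈ U <;> by_cases a3 : x ∈ E <;>
              by_cases a4 : x + h ∈ E <;> simp [indicator, a1, a2, a3, a4]
          simp only
          rw [hle]
          by_cases hh : h ∈ closedBall (0 : Sp d) R
          · rw [indicator_of_mem hh]
            have h9 := trans_set hE hU hc hfin hP h
            refine (ENNReal.le_ofReal_iff_toReal_le ?_ (by positivity)).2 (h9.trans ?_)
            · exact ne_top_of_le_ne_top hfin (measure_mono fun x hx => hx.1)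
            · exact mul_le_mul_of_nonneg_right (by simpa using hh) ENNReal.toReal_nonneg
          · rw [indicator_of_notMem hh, nonpos_iff_eq_zero]
            convert measure_empty (μ := (volume : Measure (Sp d)))
            ext x
            simp only [mem_ofPred_eq, mem_empty_iff_false, iff_false]
            rintro ⟨b1, b2, -⟩
            apply hh
            have := hR x b1 _ b2
            simpa using this
      _ = _ := by
          rw [lintegral_indicator measurableSet_closedBall, lintegral_const]
          simp [mul_comm]
  have := ENNReal.toReal_mono (by
    exact ENNReal.mul_ne_top measure_closedBall_lt_top.ne ENNReal.ofReal_ne_top) step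
  rw [ENNReal.toReal_mul, ENNReal.toReal_mul, ENNReal.toReal_ofReal (by positivity)] at this
  exact this

end DM

namespace DM
open scoped Topology
variable {d : ℕ}

def oCube {d : ℕ} (n : ℤ) (k : Fin d → ℤ) : Set (Sp d) :=
  {x | ∀ i, (k i : ℝ) * 2 ^ n < x i ∧ x i < ((k i : ℝ) + 1) * 2 ^ n}

def cCube {d : ℕ} (n : ℤ) (k : Fin d → ℤ) : Set (Sp d) :=
  {x | ∀ i, (k i : ℝ) * 2 ^ n ≤ x i ∧ x i ≤ ((k i : ℝ) + 1) * 2 ^ n}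

lemma oCube_sub (n : ℤ) (k : Fin d → ℤ) : oCube n k ⊆ dyadCube n k :=
  fun _ hx i => ⟨(hx i).1.le, (hx i).2⟩

lemma dyad_sub_cCube (n : ℤ) (k : Fin d → ℤ) : dyadCube n k ⊆ cCube n k :=
  fun _ hx i => ⟨(hx i).1, (hx i).2.le⟩

lemma oCube_eq (n : ℤ) (k : Fin d → ℤ) : oCube n k = (WithLp.ofLp : Sp d → (Fin d → ℝ)) ⁻¹'
    (pi univ fun i => Ioo ((k i : ℝ) * 2 ^ n) (((k i : ℝ) + 1) * 2 ^ n)) := by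
  ext x; simp [oCube]

lemma dyadCube_eq (n : ℤ) (k : Fin d → ℤ) : dyadCube n k = (WithLp.ofLp : Sp d → (Fin d → ℝ)) ⁻¹'
    (pi univ fun i => Ico ((k i : ℝ) * 2 ^ n) (((k i : ℝ) + 1) * 2 ^ n)) := by
  ext x; simp [dyadCube]

lemma cCube_eq (n : ℤ) (k : Fin d → ℤ) : cCube n k = (WithLp.ofLp : Sp d → (Fin d → ℝ)) ⁻¹'
    (pi univ fun i => Icc ((k i : ℝ) * 2 ^ n) (((k i : ℝ) + 1) * 2 ^ n)) := by
  ext x; simp only [cCube, mem_ofPred_eq, mem_preimage, Set.mem_pi, mem_univ, true_imp_iff, mem_Icc]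

lemma isOpen_oCube (n : ℤ) (k : Fin d → ℤ) : IsOpen (oCube n k) := by
  rw [oCube_eq]
  exact (isOpen_set_pi finite_univ fun i _ => isOpen_Ioo).preimage (PiLp.continuous_ofLp 2 _)

lemma isClosed_cCube (n : ℤ) (k : Fin d → ℤ) : IsClosed (cCube n k) := by
  rw [cCube_eq]
  exact (isClosed_set_pi fun i _ => isClosed_Icc).preimage (PiLp.continuous_ofLp 2 _)

lemma meas_dyad (n : ℤ) (k : Fin d → ℤ) : MeasurableSet (dyadCube n k) := by
  rw [dyadCube_eq]
  exact (MeasurableSet.univ_pi fun i => measurableSet_Ico).preimage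
    (PiLp.continuous_ofLp 2 _).measurable

lemma convex_oCube (n : ℤ) (k : Fin d → ℤ) : Convex ℝ (oCube n k) := by
  intro x hx y hy a b ha hb hab i
  exact (convex_Ioo ((k i : ℝ) * 2 ^ n) (((k i : ℝ) + 1) * 2 ^ n)) (hx i) (hy i) ha hb hab

lemma vol_oCube (n : ℤ) (k : Fin d → ℤ) : volume (oCube n k) = ENNReal.ofReal (((2:ℝ) ^ n) ^ d) := by
  rw [oCube_eq, (PiLp.volume_preserving_ofLp (Fin d)).measure_preimage
    (MeasurableSet.univ_pi fun i => measurableSet_Ioo).nullMeasurableSet, Real.volume_pi_Ioo]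
  rw [Finset.prod_congr rfl (g := fun _ => ENNReal.ofReal ((2:ℝ)^n)) (fun i _ => by ring_nf)]
  rw [ENNReal.ofReal_pow (by positivity)]; simp

lemma vol_cCube (n : ℤ) (k : Fin d → ℤ) : volume (cCube n k) = ENNReal.ofReal (((2:ℝ) ^ n) ^ d) := by
  rw [cCube_eq, (PiLp.volume_preserving_ofLp (Fin d)).measure_preimage
    (MeasurableSet.univ_pi fun i => measurableSet_Icc).nullMeasurableSet, Set.pi_univ_Icc,
    Real.volume_Icc_pi]
  rw [Finset.prod_congr rfl (g := fun _ => ENNReal.ofReal ((2:ℝ)^n)) (fun i _ => by ring_nf)]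
  rw [ENNReal.ofReal_pow (by positivity)]; simp

lemma vol_dyad (n : ℤ) (k : Fin d → ℤ) :
    volume (dyadCube n k) = ENNReal.ofReal (((2:ℝ) ^ n) ^ d) :=
  le_antisymm ((measure_mono (dyad_sub_cCube n k)).trans_eq (vol_cCube n k))
    ((vol_oCube n k).symm.le.trans (measure_mono (oCube_sub n k)))

lemma volr_dyad (n : ℤ) (k : Fin d → ℤ) : volume.real (dyadCube n k) = ((2:ℝ) ^ n) ^ d := by
  rw [Measure.real, vol_dyad, ENNReal.toReal_ofReal (by positivity)]

lemma o_ae_dyad (n : ℤ) (k : Fin d → ℤ) : oCube n k =ᵐ[volume] dyadCube n k :=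
  ae_eq_of_subset_of_measure_ge (oCube_sub n k) (by rw [vol_dyad, vol_oCube])
    (isOpen_oCube n k).measurableSet.nullMeasurableSet (by rw [vol_dyad]; finiteness)

lemma dyad_ae_c (n : ℤ) (k : Fin d → ℤ) : dyadCube n k =ᵐ[volume] cCube n k :=
  ae_eq_of_subset_of_measure_ge (dyad_sub_cCube n k) (by rw [vol_dyad, vol_cCube])
    (meas_dyad n k).nullMeasurableSet (by rw [vol_cCube]; finiteness)

lemma norm_le_cube {x y : Sp d} {r : ℝ} (h : ∀ i, |y i - x i| ≤ r) : ‖y - x‖ ≤ d * r := by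
  have e : y - x = ∑ i, ((y - x) i) • EuclideanSpace.single i (1 : ℝ) := by
    ext j; simp [Pi.single_apply]
  rw [e]
  refine (norm_sum_le _ _).trans ?_
  have : ∀ i ∈ (Finset.univ : Finset (Fin d)), ‖((y - x) i) • EuclideanSpace.single i (1 : ℝ)‖ ≤ r := by
    intro i _
    rw [norm_smul, EuclideanSpace.norm_single]
    simpa using h i
  refine (Finset.sum_le_card_nsmul _ _ _ this).trans ?_
  simp

lemma diam_cCube {n : ℤ} {k : Fin d → ℤ} {x y : Sp d} (hx : x ∈ cCube n k) (hy : y ∈ cCube n k) :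
    ‖y - x‖ ≤ d * 2 ^ n := by
  refine norm_le_cube fun i => ?_
  have := hx i; have := hy i
  rw [abs_le]; constructor <;> linarith

noncomputable def idx (n : ℤ) (x : Sp d) : Fin d → ℤ := fun i => ⌊x i / 2 ^ n⌋

lemma mem_dyad_iff {n : ℤ} {k : Fin d → ℤ} {x : Sp d} : x ∈ dyadCube n k ↔ idx n x = k := by
  have h2 : (0:ℝ) < 2 ^ n := by positivity
  simp only [dyadCube, mem_ofPred_eq, idx, funext_iff]
  refine forall_congr' fun i => ?_
  rw [Int.floor_eq_iff, le_div_iff₀ h2, div_lt_iff₀ h2]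

lemma mem_idx (n : ℤ) (x : Sp d) : x ∈ dyadCube n (idx n x) := mem_dyad_iff.2 rfl

lemma disj_dyad {n : ℤ} {k k' : Fin d → ℤ} (h : k ≠ k') :
    Disjoint (dyadCube n k) (dyadCube n k') :=
  disjoint_left.2 fun _ h1 h2 => h ((mem_dyad_iff.1 h1).symm.trans (mem_dyad_iff.1 h2))

lemma nested {n m : ℤ} (hnm : n ≤ m) {k j : Fin d → ℤ} {x : Sp d} (h1 : x ∈ dyadCube n k)
    (h2 : x ∈ dyadCube m j) : dyadCube n k ⊆ dyadCube m j := by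
  obtain ⟨a, rfl⟩ := Int.le.dest hnm
  intro y hy i
  have hp : (0:ℝ) < 2 ^ n := by positivity
  have e : (2:ℝ) ^ (n + (a:ℤ)) = 2 ^ a * 2 ^ n := by
    rw [zpow_add₀ two_ne_zero, zpow_natCast, mul_comm]
  have a1 := h1 i
  have a2 := h2 i
  have a3 := hy i
  rw [e] at a2 ⊢
  have b1 : (j i : ℝ) * 2 ^ a < k i + 1 := by
    have : (j i : ℝ) * 2 ^ a * 2 ^ n < (k i + 1) * 2 ^ n := by linarith
    exact lt_of_mul_lt_mul_right this hp.le
  have b2 : (k i : ℝ) < (j i + 1) * 2 ^ a := by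
    have : (k i : ℝ) * 2 ^ n < (j i + 1) * 2 ^ a * 2 ^ n := by linarith
    exact lt_of_mul_lt_mul_right this hp.le
  have c1 : (j i) * 2 ^ a ≤ k i := by
    have : (j i) * 2 ^ a < k i + 1 := by exact_mod_cast b1
    omega
  have c2 : k i + 1 ≤ (j i + 1) * 2 ^ a := by
    have : k i < (j i + 1) * 2 ^ a := by exact_mod_cast b2
    omega
  have c1' : (j i : ℝ) * 2 ^ a ≤ k i := by exact_mod_cast c1
  have c2' : (k i : ℝ) + 1 ≤ (j i + 1) * 2 ^ a := by exact_mod_cast c2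
  have := mul_le_mul_of_nonneg_right c1' hp.le
  have := mul_le_mul_of_nonneg_right c2' hp.le
  constructor <;> linarith

/-- children -/
def chld (k : Fin d → ℤ) (b : Fin d → Bool) : Fin d → ℤ := fun i => 2 * k i + (if b i then 1 else 0)

lemma chld_inj (k : Fin d → ℤ) : Function.Injective (chld k) := by
  intro b b' h
  ext i
  have := congrFun h i
  unfold chld at this
  cases hb : b i <;> cases hb' : b' i <;> simp_all

lemma chld_sub (n : ℤ) (k : Fin d → ℤ) (b) : dyadCube (n - 1) (chld k b) ⊆ dyadCube n k := by
  intro x hx i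
  have h := hx i
  have e : (2:ℝ) ^ n = 2 * 2 ^ (n - 1) := by
    rw [zpow_sub_one₀ two_ne_zero]; ring
  have hp : (0:ℝ) < 2 ^ (n-1) := by positivity
  unfold chld at h
  rw [e]
  cases hb : b i <;> simp only [hb, Bool.false_eq_true, if_false, if_true] at h <;> push_cast at h <;>
    constructor <;> nlinarith [h.1, h.2]

lemma chld_o_sub (n : ℤ) (k : Fin d → ℤ) (b) : oCube (n - 1) (chld k b) ⊆ oCube n k := by
  intro x hx i
  have h := hx i
  have e : (2:ℝ) ^ n = 2 * 2 ^ (n - 1) := by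
    rw [zpow_sub_one₀ two_ne_zero]; ring
  have hp : (0:ℝ) < 2 ^ (n-1) := by positivity
  unfold chld at h
  rw [e]
  cases hb : b i <;> simp only [hb, Bool.false_eq_true, if_false, if_true] at h <;> push_cast at h <;>
    constructor <;> nlinarith [h.1, h.2]

lemma iUnion_chld (n : ℤ) (k : Fin d → ℤ) : ⋃ b, dyadCube (n - 1) (chld k b) = dyadCube n k := by
  refine subset_antisymm (iUnion_subset fun b => chld_sub n k b) fun x hx => ?_
  refine mem_iUnion.2 ⟨fun i => decide ((2 * (k i : ℝ) + 1) * 2 ^ (n-1) ≤ x i), fun i => ?_⟩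
  have h := hx i
  have e : (2:ℝ) ^ n = 2 * 2 ^ (n - 1) := by
    rw [zpow_sub_one₀ two_ne_zero]; ring
  rw [e] at h
  unfold chld
  by_cases hb : (2 * (k i : ℝ) + 1) * 2 ^ (n-1) ≤ x i
  · simp only [hb, decide_true, if_true]; push_cast
    constructor <;> linarith [h.1, h.2]
  · simp only [hb, decide_false, Bool.false_eq_true, if_false]; push_cast
    push Not at hb
    constructor <;> linarith [h.1, h.2]

lemma vol_chld (n : ℤ) (k : Fin d → ℤ) (b) :
    volume.real (dyadCube n k) = 2 ^ d * volume.real (dyadCube (n-1) (chld k b)) := by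
  rw [volr_dyad, volr_dyad, ← mul_pow]
  congr 1
  rw [zpow_sub_one₀ two_ne_zero]; ring

lemma sum_chld (n : ℤ) (k : Fin d → ℤ) {S : Set (Sp d)} (hS : MeasurableSet S) :
    volume.real (S ∩ dyadCube n k) = ∑ b, volume.real (S ∩ dyadCube (n-1) (chld k b)) := by
  rw [← iUnion_chld, inter_iUnion]
  rw [Measure.real, measure_iUnion, tsum_fintype, ENNReal.toReal_sum]
  · rfl
  · intro b _
    exact ne_top_of_le_ne_top (by rw [vol_dyad]; finiteness) (measure_mono inter_subset_right)
  · intro b b' hb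
    exact (disj_dyad fun h => hb (chld_inj k h)).mono inter_subset_right inter_subset_right
  · exact fun b => hS.inter (meas_dyad _ _)

lemma density {E : Set (Sp d)} (hE : MeasurableSet E) :
    ∀ᵐ x, x ∈ E → Tendsto (fun j : ℕ => volume (E ∩ dyadCube (-(j:ℤ)) (idx (-(j:ℤ)) x)) /
      volume (dyadCube (-(j:ℤ)) (idx (-(j:ℤ)) x))) atTop (𝓝 1) := by
  set C : NNReal := 3 ^ d + (3 * (d + 1)) ^ d * (volume (closedBall (0 : Sp d) 1)).toNNReal with hC
  have hfr : Module.finrank ℝ (Sp d) = d := by simp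
  have hball : ∀ (x : Sp d) (r : ℝ), 0 ≤ r → volume (closedBall x r) =
      ENNReal.ofReal (r ^ d) * volume (closedBall (0 : Sp d) 1) := by
    intro x r hr
    rw [Measure.addHaar_closedBall' _ _ hr, hfr]
  have h0 : ∀ x : Sp d, ∃ᶠ r in 𝓝[>] 0, volume (closedBall x (3 * r)) ≤ C * volume (closedBall x r) := by
    intro x
    refine Eventually.frequently ?_
    filter_upwards [self_mem_nhdsWithin] with r hr
    have hr : 0 < r := hr
    rw [hball x _ (by positivity), hball x r hr.le, mul_pow, ENNReal.ofReal_mul (by positivity), mul_assoc]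
    refine mul_le_mul_left ?_ _
    rw [hC, ENNReal.ofReal_pow (by norm_num)]
    push_cast
    simp
  set v := Vitali.vitaliFamily (volume : Measure (Sp d)) C h0 with hv
  have key := v.ae_tendsto_measure_inter_div_of_measurableSet hE
  filter_upwards [key] with x hx hxE
  rw [indicator_of_mem hxE] at hx
  have ht : Tendsto (fun j : ℕ => cCube (-(j:ℤ)) (idx (-(j:ℤ)) x)) atTop (v.filterAt x) := by
    have hsub : ∀ j : ℕ, cCube (-(j:ℤ)) (idx (-(j:ℤ)) x) ⊆
        closedBall x ((d + 1) * (2:ℝ) ^ (-(j:ℤ))) := by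
      intro j y hy
      rw [mem_closedBall, dist_eq_norm]
      have := diam_cCube (dyad_sub_cCube _ _ (mem_idx (-(j:ℤ)) x)) hy
      have : (0:ℝ) ≤ 2 ^ (-(j:ℤ)) := by positivity
      linarith
    rw [VitaliFamily.tendsto_filterAt_iff]
    constructor
    · refine Eventually.of_forall fun j => ⟨isClosed_cCube _ _, ?_, (d + 1) * (2:ℝ) ^ (-(j:ℤ)), hsub j, ?_⟩
      · have : (oCube (-(j:ℤ)) (idx (-(j:ℤ)) x)).Nonempty := by
          rw [nonempty_iff_ne_empty]
          intro h
          have h' := vol_oCube (-(j:ℤ)) (idx (-(j:ℤ)) x)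
          rw [h, measure_empty] at h'
          have : (0:ℝ) < ((2:ℝ) ^ (-(j:ℤ))) ^ d := by positivity
          rw [eq_comm, ENNReal.ofReal_eq_zero] at h'
          linarith
        exact this.mono (interior_maximal ((oCube_sub _ _).trans (dyad_sub_cCube _ _))
          (isOpen_oCube _ _))
      · rw [hball x _ (by positivity), vol_cCube, ← mul_assoc, mul_pow,
          ENNReal.ofReal_mul (by positivity), mul_right_comm]
        refine mul_le_mul_left ?_ _
        rw [hC]
        push_cast
        rw [ENNReal.coe_toNNReal measure_closedBall_lt_top.ne]
        refine le_add_left (mul_le_mul_left (le_of_eq ?_) _)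
        rw [ENNReal.ofReal_pow (by positivity), ENNReal.ofReal_mul (by positivity), ENNReal.ofReal_add (by positivity) (by positivity)]
        simp
    · intro ε hε
      have : Tendsto (fun j : ℕ => (d + 1) * (2:ℝ) ^ (-(j:ℤ))) atTop (𝓝 ((d + 1) * 0)) := by
        refine Tendsto.const_mul _ ?_
        have := tendsto_pow_atTop_nhds_zero_of_lt_one (r := (2:ℝ)⁻¹) (by norm_num) (by norm_num)
        refine this.congr fun j => ?_
        rw [zpow_neg, zpow_natCast, inv_pow]
      rw [mul_zero] at this
      filter_upwards [this.eventually (gt_mem_nhds hε)] with j hj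
      exact (hsub j).trans (closedBall_subset_closedBall hj.le)
  have := hx.comp ht
  refine this.congr fun j => ?_
  simp only [Function.comp]
  rw [measure_congr (dyad_ae_c _ _), measure_congr ((ae_eq_refl E).inter (dyad_ae_c _ _))]

end DM

namespace DM
open scoped Topology
variable {d : ℕ}

noncomputable def cP (d : ℕ) : ℝ := volume.real (closedBall (0 : Sp d) d) * d

lemma cP_nonneg (d : ℕ) : 0 ≤ cP d := by unfold cP; positivity

lemma fin_inter_dyad (S : Set (Sp d)) (n : ℤ) (k : Fin d → ℤ) : volume (S ∩ dyadCube n k) ≠ ⊤ :=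
  ne_top_of_le_ne_top (by rw [vol_dyad]; finiteness) (measure_mono inter_subset_right)

lemma inter_add_sdiff {E : Set (Sp d)} (hE : MeasurableSet E) (n : ℤ) (k : Fin d → ℤ) :
    volume.real (E ∩ dyadCube n k) + volume.real (dyadCube n k \ E) = ((2:ℝ) ^ n) ^ d := by
  rw [← volr_dyad n k, inter_comm]
  exact measureReal_inter_add_sdiff hE (by rw [vol_dyad]; finiteness)

lemma poinc_cube {E : Set (Sp d)} (hE : MeasurableSet E) (n : ℤ) (k : Fin d → ℤ)
    (hP : Per E (oCube n k) ≠ ⊤) :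
    volume.real (E ∩ dyadCube n k) * volume.real (dyadCube n k \ E) ≤
      cP d * ((2:ℝ) ^ n) ^ d * 2 ^ n * (Per E (oCube n k)).toReal := by
  have h := poincare hE (isOpen_oCube n k) (convex_oCube n k) (by rw [vol_oCube]; finiteness) hP
    (R := 2 ^ n * d) (by positivity) (fun x hx y hy => by
      rw [mul_comm]
      exact diam_cCube (dyad_sub_cCube n k (oCube_sub n k hx)) (dyad_sub_cCube n k (oCube_sub n k hy)))
  have e1 : volume.real (E ∩ oCube n k) = volume.real (E ∩ dyadCube n k) :=
    measureReal_congr ((ae_eq_refl E).inter (o_ae_dyad n k))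
  have e2 : volume.real (oCube n k \ E) = volume.real (dyadCube n k \ E) :=
    measureReal_congr ((o_ae_dyad n k).diff (ae_eq_refl E))
  have e3 : volume.real (closedBall (0 : Sp d) (2 ^ n * d)) =
      ((2:ℝ) ^ n) ^ d * volume.real (closedBall (0 : Sp d) d) := by
    rw [Measure.real, Measure.addHaar_closedBall_mul _ _ (by positivity) (by positivity)]
    rw [ENNReal.toReal_mul, ENNReal.toReal_ofReal (by positivity)]
    simp [Measure.real]
  rw [e1, e2, e3] at h
  unfold cP
  linarith

def bad (E : Set (Sp d)) (s : ℤ) : Set (Sp d) :=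
  {x | volume.real (E ∩ dyadCube s (idx s x)) ≤ ((2:ℝ) ^ s) ^ d / (2 * 2 ^ d)}

lemma meas_idx (s : ℤ) : Measurable (idx (d := d) s) := by
  unfold idx
  refine measurable_pi_lambda _ fun i => Int.measurable_floor.comp ?_
  fun_prop

lemma meas_bad (E : Set (Sp d)) (s : ℤ) : MeasurableSet (bad E s) := by
  have : bad E s = idx s ⁻¹' {k | volume.real (E ∩ dyadCube s k) ≤ ((2:ℝ) ^ s) ^ d / (2 * 2 ^ d)} := rfl
  rw [this]
  exact meas_idx s (MeasurableSet.of_discrete)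

lemma iso_main {E : Set (Sp d)} (hd : 1 ≤ d) (hE : MeasurableSet E) {L : ℝ} (hL : 0 ≤ L)
    (n : ℤ) (k : Fin d → ℤ) (hP : Per E (oCube n k) ≠ ⊤) {A : ℝ} (hA : 0 ≤ A)
    (h1 : volume.real (E ∩ dyadCube n k) ≤ ((2:ℝ) ^ n) ^ d / 2)
    (h2 : volume.real (E ∩ dyadCube n k) ≤ L ^ d)
    (hb : ¬ volume.real (E ∩ dyadCube n k) ≤ ((2:ℝ) ^ n) ^ d / (2 * 2 ^ d)) :
    volume.real (E ∩ dyadCube n k) ≤ 8 * cP d * L * (Per E (oCube n k)).toReal + A := by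
  have hpc := poinc_cube hE n k hP
  have hs := inter_add_sdiff hE n k
  push Not at hb
  have hcP := cP_nonneg d
  set a := volume.real (E ∩ dyadCube n k)
  set b := volume.real (dyadCube n k \ E)
  set p := (Per E (oCube n k)).toReal
  have hp : 0 ≤ p := ENNReal.toReal_nonneg
  have hl : (0:ℝ) < 2 ^ n := by positivity
  set l : ℝ := 2 ^ n
  have ha : 0 ≤ a := measureReal_nonneg
  have hl4 : l ≤ 4 * L := by
    by_contra hcon
    push Not at hcon
    have h3 : L ≤ l / 4 := by linarith
    have h4 : L ^ d ≤ (l / 4) ^ d := by gcongr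
    have h5 : (2:ℝ) * 2 ^ d ≤ 4 ^ d := by
      rw [show (4:ℝ) = 2 * 2 by norm_num, mul_pow]
      gcongr
      calc (2:ℝ) = 2 ^ 1 := by norm_num
        _ ≤ 2 ^ d := by gcongr; norm_num
    have h6 : (l / 4) ^ d ≤ l ^ d / (2 * 2 ^ d) := by
      rw [div_pow]; gcongr
    linarith
  have hld : 0 < l ^ d := by positivity
  have h7 : a * (l ^ d / 2) ≤ a * b := by gcongr; linarith
  have h8 : a ≤ 2 * cP d * l * p := by
    have : a * (l ^ d / 2) ≤ (2 * cP d * l * p) * (l ^ d / 2) := by linarith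
    exact le_of_mul_le_mul_right this (by positivity)
  have h9 : 2 * cP d * l * p ≤ 2 * cP d * (4 * L) * p := by gcongr
  linarith

lemma iso_step {E : Set (Sp d)} (hd : 1 ≤ d) (hE : MeasurableSet E) {L : ℝ} (hL : 0 ≤ L) (N : ℕ) :
    ∀ (n : ℤ) (k : Fin d → ℤ), Per E (oCube n k) ≠ ⊤ →
      volume.real (E ∩ dyadCube n k) ≤ ((2:ℝ) ^ n) ^ d / 2 → volume.real (E ∩ dyadCube n k) ≤ L ^ d →
      volume.real (E ∩ dyadCube n k) ≤ 8 * cP d * L * (Per E (oCube n k)).toReal +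
        volume.real ((E ∩ bad E (n - N)) ∩ dyadCube n k) := by
  induction N with
  | zero =>
    intro n k hP h1 h2
    by_cases hb : volume.real (E ∩ dyadCube n k) ≤ ((2:ℝ) ^ n) ^ d / (2 * 2 ^ d)
    · have : (E ∩ bad E (n - (0:ℕ))) ∩ dyadCube n k = E ∩ dyadCube n k := by
        ext x
        simp only [mem_inter_iff, bad, mem_ofPred_eq, Nat.cast_zero, sub_zero]
        refine ⟨fun h => ⟨h.1.1, h.2⟩, fun h => ⟨⟨h.1, ?_⟩, h.2⟩⟩
        rw [mem_dyad_iff.1 h.2]; exact hb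
      rw [this]
      have := cP_nonneg d
      have : 0 ≤ 8 * cP d * L * (Per E (oCube n k)).toReal := by positivity
      linarith
    · exact iso_main hd hE hL n k hP measureReal_nonneg h1 h2 hb
  | succ N ih =>
    intro n k hP h1 h2
    by_cases hb : volume.real (E ∩ dyadCube n k) ≤ ((2:ℝ) ^ n) ^ d / (2 * 2 ^ d)
    · have hPc : ∀ b, Per E (oCube (n-1) (chld k b)) ≠ ⊤ := fun b =>
        ne_top_of_le_ne_top hP (Per_mono hE (chld_o_sub n k b))
      have hle : ∀ b, volume.real (E ∩ dyadCube (n-1) (chld k b)) ≤ volume.real (E ∩ dyadCube n k) :=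
        fun b => measureReal_mono (inter_subset_inter_right _ (chld_sub n k b)) (fin_inter_dyad _ _ _)
      have key : ∀ b, _ := fun b => ih (n-1) (chld k b) (hPc b) (by
        refine (hle b).trans (hb.trans_eq ?_)
        rw [zpow_sub_one₀ two_ne_zero, mul_pow, inv_pow]; field_simp) ((hle b).trans h2)
      rw [sum_chld n k hE, sum_chld n k (hE.inter (meas_bad _ _))]
      refine (Finset.sum_le_sum fun b _ => key b).trans ?_
      rw [Finset.sum_add_distrib, ← Finset.mul_sum]
      have hs := sum_Per_le_real hE Finset.univ hP (fun b => oCube (n-1) (chld k b))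
        (fun b _ => chld_o_sub n k b) (fun b _ b' _ hbb =>
          (disj_dyad (fun h => hbb (chld_inj k h))).mono (oCube_sub _ _) (oCube_sub _ _))
      have e : n - 1 - (N:ℤ) = n - ((N + 1 : ℕ) : ℤ) := by push_cast; ring
      rw [e]
      have := cP_nonneg d
      gcongr
    · exact iso_main hd hE hL n k hP measureReal_nonneg h1 h2 hb


lemma iso {E : Set (Sp d)} (hd : 1 ≤ d) (hE : MeasurableSet E) {L : ℝ} (hL : 0 ≤ L)
    (n : ℤ) (k : Fin d → ℤ) (hP : Per E (oCube n k) ≠ ⊤)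
    (h1 : volume.real (E ∩ dyadCube n k) ≤ ((2:ℝ) ^ n) ^ d / 2)
    (h2 : volume.real (E ∩ dyadCube n k) ≤ L ^ d) :
    volume.real (E ∩ dyadCube n k) ≤ 8 * cP d * L * (Per E (oCube n k)).toReal := by
  have hfm : IsFiniteMeasure (volume.restrict (dyadCube n k)) :=
    ⟨by rw [Measure.restrict_apply_univ, vol_dyad]; finiteness⟩
  have key : ∀ᵐ x ∂(volume.restrict (dyadCube n k)), ∀ᶠ j : ℕ in atTop,
      (x ∈ E ∩ bad E (-(j:ℤ)) ↔ x ∈ (∅ : Set (Sp d))) := by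
    refine ae_restrict_of_ae ?_
    filter_upwards [density hE] with x hx
    by_cases hxE : x ∈ E
    · have h := hx hxE
      have h' := h.eventually (lt_mem_nhds (show (1/2 : ℝ≥0∞) < 1 from ENNReal.half_lt_self one_ne_zero ENNReal.one_ne_top))
      filter_upwards [h'] with j hj
      simp only [mem_inter_iff, mem_empty_iff_false, iff_false, not_and]
      intro _ hbad
      simp only [bad, mem_ofPred_eq] at hbad
      set s : ℤ := -(j:ℤ)
      have hv : volume (dyadCube s (idx s x)) = ENNReal.ofReal (((2:ℝ) ^ s) ^ d) := vol_dyad _ _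
      rw [ENNReal.lt_div_iff_mul_lt (Or.inl (by rw [hv]; simp; positivity)) (Or.inl (by rw [hv]; finiteness))] at hj
      have h3 := (ENNReal.toReal_lt_toReal (by rw [hv]; finiteness) (fin_inter_dyad _ _ _)).2 hj
      rw [ENNReal.toReal_mul] at h3
      change _ < volume.real _ at h3
      change _ * volume.real _ < _ at h3
      rw [volr_dyad] at h3
      simp at h3
      have h4 : ((2:ℝ) ^ s) ^ d / (2 * 2 ^ d) ≤ ((2:ℝ) ^ s) ^ d / (2 * 1) := by
        gcongr
        exact one_le_pow₀ (by norm_num)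
      linarith
    · exact Eventually.of_forall fun j => by simp [hxE]
  have hlim := tendsto_measure_of_ae_tendsto_indicator_of_isFiniteMeasure (μ := volume.restrict (dyadCube n k)) atTop
    (A := ∅) (As := fun j : ℕ => E ∩ bad E (-(j:ℤ))) MeasurableSet.empty
    (fun j => hE.inter (meas_bad _ _)) key
  have hlim2 : Tendsto (fun j : ℕ => volume.real ((E ∩ bad E (-(j:ℤ))) ∩ dyadCube n k)) atTop (𝓝 0) := by
    have := (ENNReal.tendsto_toReal (by simp)).comp hlim
    simp only [measure_empty, ENNReal.toReal_zero] at this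
    refine this.congr fun j => ?_
    simp only [Function.comp, Measure.real]
    rw [Measure.restrict_apply (hE.inter (meas_bad _ _))]
  have hev : ∀ᶠ j : ℕ in atTop, volume.real (E ∩ dyadCube n k) ≤
      8 * cP d * L * (Per E (oCube n k)).toReal + volume.real ((E ∩ bad E (-(j:ℤ))) ∩ dyadCube n k) := by
    filter_upwards [eventually_ge_atTop (-n).toNat] with j hj
    have h := iso_step hd hE hL (n + j).toNat n k hP h1 h2
    have e : n - ((n + j).toNat : ℤ) = -(j:ℤ) := by omega
    rwa [e] at h
  have := ge_of_tendsto (hlim2.const_add (8 * cP d * L * (Per E (oCube n k)).toReal)) hev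
  simpa using this

end DM

namespace DM
open scoped Topology
variable {d : ℕ}

lemma sdiff_bound {E : Set (Sp d)} (hd : 1 ≤ d) (hE : MeasurableSet E)
    (n : ℤ) (k : Fin d → ℤ) (hP : Per E (oCube n k) ≠ ⊤) {t : ℝ} (ht0 : 0 < t) (ht1 : t ≤ 1)
    (h : t * ((2:ℝ) ^ n) ^ d < volume.real (E ∩ dyadCube n k)) :
    volume.real (dyadCube n k \ E) / 2 ^ n ≤
      8 * cP d * t ^ ((1:ℝ) / d - 1) * (Per E (oCube n k)).toReal := by
  have hpc := poinc_cube hE n k hP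
  have hiso := fun L hL h1 => iso (L := L) hd hE hL n k hP h1
  have hs := inter_add_sdiff hE n k
  have hcP := cP_nonneg d
  have hb0 : 0 ≤ volume.real (dyadCube n k \ E) := measureReal_nonneg
  set a := volume.real (E ∩ dyadCube n k)
  set b := volume.real (dyadCube n k \ E)
  set p := (Per E (oCube n k)).toReal
  have hp : 0 ≤ p := ENNReal.toReal_nonneg
  have hl : (0:ℝ) < 2 ^ n := by positivity
  set l : ℝ := 2 ^ n
  have hld : 0 < l ^ d := by positivity
  have hd0 : (0:ℝ) < d := by exact_mod_cast hd
  have hexp : (1:ℝ) / d - 1 ≤ 0 := by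
    rw [sub_nonpos, div_le_one hd0]; exact_mod_cast hd
  have ht2 : 1 ≤ t ^ ((1:ℝ) / d - 1) := Real.one_le_rpow_of_pos_of_le_one_of_nonpos ht0 ht1 hexp
  rw [div_le_iff₀ hl]
  by_cases hhalf : a ≤ l ^ d / 2
  · have ha : 0 < a := lt_of_le_of_lt (by positivity) h
    set θ := a / l ^ d with hθ
    have hθ0 : 0 < θ := by positivity
    have htθ : t < θ := by rw [hθ, lt_div_iff₀ hld]; exact h
    have h1 := hiso (θ ^ ((1:ℝ) / d) * l) (by positivity) hhalf (by
      rw [mul_pow, ← Real.rpow_natCast (θ ^ ((1:ℝ)/d)) d, ← Real.rpow_mul hθ0.le,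
        one_div_mul_cancel hd0.ne', Real.rpow_one, hθ, div_mul_cancel₀ _ hld.ne'])
    have h2 : b ≤ l ^ d := by linarith
    have h3 : l ^ d = a / θ := by rw [hθ]; field_simp
    have h4 : a / θ ≤ 8 * cP d * (θ ^ ((1:ℝ) / d) * l) * p / θ := by gcongr
    have h5 : 8 * cP d * (θ ^ ((1:ℝ) / d) * l) * p / θ = 8 * cP d * θ ^ ((1:ℝ) / d - 1) * p * l := by
      rw [Real.rpow_sub_one hθ0.ne']; ring
    have h6 : θ ^ ((1:ℝ) / d - 1) ≤ t ^ ((1:ℝ) / d - 1) :=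
      Real.rpow_le_rpow_of_nonpos ht0 htθ.le hexp
    have h7 : 8 * cP d * θ ^ ((1:ℝ) / d - 1) * p * l ≤ 8 * cP d * t ^ ((1:ℝ) / d - 1) * p * l := by
      gcongr
    linarith
  · push Not at hhalf
    have h7 : (l ^ d / 2) * b ≤ a * b := by gcongr
    have h8 : b ≤ 2 * cP d * l * p := by
      have : (l ^ d / 2) * b ≤ (l ^ d / 2) * (2 * cP d * l * p) := by linarith
      exact le_of_mul_le_mul_left this (by positivity)
    have h9 : 8 * cP d * 1 * p * l ≤ 8 * cP d * t ^ ((1:ℝ) / d - 1) * p * l := by gcongr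
    have : 0 ≤ cP d * p * l := by positivity
    linarith

noncomputable def ctr (n : ℤ) (k : Fin d → ℤ) : Sp d := WithLp.toLp 2 fun i => ((k i : ℝ) + 1 / 2) * 2 ^ n

lemma ctr_apply (n : ℤ) (k : Fin d → ℤ) (i) : ctr n k i = ((k i : ℝ) + 1 / 2) * 2 ^ n := rfl

/-- one-coordinate cutoff -/
noncomputable def cut1 (n : ℤ) (k : Fin d → ℤ) (m : ℝ) (i : Fin d) (x : Sp d) : ℝ :=
  Real.smoothTransition (m * (1 / 4 - ((x i - ctr n k i) / 2 ^ n) ^ 2) - 1)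

noncomputable def cut (n : ℤ) (k : Fin d → ℤ) (m : ℝ) (x : Sp d) : ℝ := ∏ i, cut1 n k m i x

lemma coord_hasFDerivAt (i : Fin d) (x : Sp d) :
    HasFDerivAt (fun x : Sp d => x i) (EuclideanSpace.proj (𝕜 := ℝ) i : Sp d →L[ℝ] ℝ) x :=
  (EuclideanSpace.proj (𝕜 := ℝ) i : Sp d →L[ℝ] ℝ).hasFDerivAt

lemma cut1_contDiff (n : ℤ) (k : Fin d → ℤ) (m : ℝ) (i : Fin d) : ContDiff ℝ 1 (cut1 n k m i) := by
  unfold cut1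
  have h : ContDiff ℝ 1 (fun x : Sp d => x i) := (EuclideanSpace.proj (𝕜 := ℝ) i : Sp d →L[ℝ] ℝ).contDiff
  refine Real.smoothTransition.contDiff.comp ?_
  fun_prop

lemma cut_contDiff (n : ℤ) (k : Fin d → ℤ) (m : ℝ) : ContDiff ℝ 1 (cut n k m) := by
  unfold cut
  exact contDiff_prod fun i _ => cut1_contDiff n k m i

lemma cut1_fderiv (n : ℤ) (k : Fin d → ℤ) (m : ℝ) (i : Fin d) (x : Sp d) :
    HasFDerivAt (cut1 n k m i) ((deriv Real.smoothTransition
      (m * (1 / 4 - ((x i - ctr n k i) / 2 ^ n) ^ 2) - 1) * (m * (-2 * ((x i - ctr n k i) / 2 ^ n) / 2 ^ n))) •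
      (EuclideanSpace.proj (𝕜 := ℝ) i : Sp d →L[ℝ] ℝ)) x := by
  have h1 : HasDerivAt (fun s : ℝ => m * (1 / 4 - ((s - ctr n k i) / 2 ^ n) ^ 2) - 1)
      (m * (-2 * ((x i - ctr n k i) / 2 ^ n) / 2 ^ n)) (x i) := by
    have := ((((((hasDerivAt_id (x i)).sub_const (ctr n k i)).div_const ((2:ℝ) ^ n)).pow 2).const_sub
      (1/4)).const_mul m).sub_const 1
    have e : m * (-2 * ((x i - ctr n k i) / 2 ^ n) / 2 ^ n) =
        m * -(((2:ℕ):ℝ) * ((id (x i) - ctr n k i) / 2 ^ n) ^ (2 - 1) * (1 / 2 ^ n)) := by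
      simp only [id, Nat.cast_ofNat]; ring
    rw [e]
    exact this
  have h2 : HasDerivAt Real.smoothTransition (deriv Real.smoothTransition
      (m * (1 / 4 - ((x i - ctr n k i) / 2 ^ n) ^ 2) - 1)) (m * (1 / 4 - ((x i - ctr n k i) / 2 ^ n) ^ 2) - 1) :=
    ((Real.smoothTransition.contDiff (n := 1)).differentiable one_ne_zero _).hasDerivAt
  have h3 := h2.comp (x i) h1
  exact HasDerivAt.comp_hasFDerivAt (f := fun x : Sp d => x i) x h3 (coord_hasFDerivAt i x)

lemma deriv_st_nonneg (s : ℝ) : 0 ≤ deriv Real.smoothTransition s := Real.smoothTransition.monotone.deriv_nonneg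

lemma deriv_st_zero {s : ℝ} (hs : 1 < s) : deriv Real.smoothTransition s = 0 := by
  have : Real.smoothTransition =ᶠ[𝓝 s] fun _ => 1 := by
    filter_upwards [lt_mem_nhds hs] with y hy
    exact Real.smoothTransition.one_of_one_le hy.le
  rw [this.deriv_eq]; simp

lemma cut_grad (n : ℤ) (k : Fin d → ℤ) {m : ℝ} (hm : 16 ≤ m) (x v : Sp d) (hv : ‖v‖ ≤ 1) :
    |fderiv ℝ (cut n k m) x v| ≤ -(4 / 2 ^ n) * fderiv ℝ (cut n k m) x (x - ctr n k) := by
  classical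
  have hfd := HasFDerivAt.finsetProd (u := Finset.univ) (fun i _ => cut1_fderiv n k m i x)
  have hfd2 : HasFDerivAt (cut n k m) _ x := hfd
  rw [hfd2.fderiv]
  have hpr : ∀ (i : Fin d) (y : Sp d), (EuclideanSpace.proj (𝕜 := ℝ) i : Sp d →L[ℝ] ℝ) y = y i := fun _ _ => rfl
  simp only [sum_apply, smul_apply, smul_eq_mul, hpr, PiLp.sub_apply]
  have hl : (0:ℝ) < 2 ^ n := by positivity
  rw [Finset.mul_sum]
  refine (Finset.abs_sum_le_sum_abs _ _).trans (Finset.sum_le_sum fun i _ => ?_)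
  have hA : 0 ≤ ∏ j ∈ Finset.univ.erase i, cut1 n k m j x :=
    Finset.prod_nonneg fun _ _ => Real.smoothTransition.nonneg _
  set A := ∏ j ∈ Finset.univ.erase i, cut1 n k m j x
  have hxt : x i - ctr n k i = 2 ^ n * ((x i - ctr n k i) / 2 ^ n) := by field_simp
  rw [hxt]
  have e2 : 2 ^ n * ((x i - ctr n k i) / 2 ^ n) / 2 ^ n = (x i - ctr n k i) / 2 ^ n := by field_simp
  rw [e2]
  set t := (x i - ctr n k i) / 2 ^ n
  set l : ℝ := 2 ^ n
  have hvi : |v i| ≤ 1 := by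
    have := PiLp.norm_apply_le v i
    rw [Real.norm_eq_abs] at this
    linarith
  have hm0 : 0 ≤ m := by linarith
  by_cases hs : 1 < m * (1 / 4 - t ^ 2) - 1
  · rw [deriv_st_zero hs]; simp
  have hD := deriv_st_nonneg (m * (1 / 4 - t ^ 2) - 1)
  set D := deriv Real.smoothTransition (m * (1 / 4 - t ^ 2) - 1)
  push Not at hs
  have ht : 1 / 8 ≤ t ^ 2 := by nlinarith
  have ht2 : |t| ≤ 4 * t ^ 2 := by
    have h3 : 1 / 4 ≤ |t| := by
      by_contra hcon
      push Not at hcon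
      have : |t| ^ 2 < (1/4) ^ 2 := by gcongr
      rw [sq_abs] at this
      norm_num at this
      linarith
    rw [← sq_abs]; nlinarith
  have e3 : A * (D * (m * (-2 * t / l)) * v i) = (A * D * m * 2 / l) * (-(t * v i)) := by ring
  have e4 : -(4 / l) * (A * (D * (m * (-2 * t / l)) * (l * t))) = (A * D * m * 2 / l) * (4 * t ^ 2) := by
    field_simp
  rw [e3, e4, abs_mul, abs_of_nonneg (show 0 ≤ A * D * m * 2 / l by positivity), abs_neg, abs_mul]
  refine mul_le_mul_of_nonneg_left ?_ (by positivity)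
  calc |t| * |v i| ≤ |t| * 1 := by gcongr
    _ ≤ _ := by linarith

lemma cut_mem (n : ℤ) (k : Fin d → ℤ) (m : ℝ) (x : Sp d) : cut n k m x ∈ Icc (0:ℝ) 1 :=
  ⟨Finset.prod_nonneg fun _ _ => Real.smoothTransition.nonneg _,
    Finset.prod_le_one (fun _ _ => Real.smoothTransition.nonneg _) fun _ _ => Real.smoothTransition.le_one _⟩

lemma cut_supp (n : ℤ) (k : Fin d → ℤ) {m : ℝ} (hm : 16 ≤ m) : tsupport (cut n k m) ⊆ oCube n k := by
  have hcl : IsClosed {x : Sp d | ∀ i, 1 / m ≤ 1 / 4 - ((x i - ctr n k i) / 2 ^ n) ^ 2} := by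
    have : {x : Sp d | ∀ i, 1 / m ≤ 1 / 4 - ((x i - ctr n k i) / 2 ^ n) ^ 2} =
      ⋂ i, {x : Sp d | 1 / m ≤ 1 / 4 - ((x i - ctr n k i) / 2 ^ n) ^ 2} := by ext; simp
    rw [this]
    refine isClosed_iInter fun i => isClosed_le continuous_const ?_
    fun_prop
  have hm0 : 0 < m := by linarith
  have hl : (0:ℝ) < 2 ^ n := by positivity
  refine (closure_minimal ?_ hcl).trans ?_
  · intro x hx i
    by_contra hcon
    push Not at hcon
    refine hx (Finset.prod_eq_zero (Finset.mem_univ i) (Real.smoothTransition.zero_of_nonpos ?_))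
    rw [lt_div_iff₀ hm0] at hcon
    linarith
  · intro x hx i
    have h := hx i
    have h0 : 0 < 1 / m := by positivity
    have h1 : ((x i - ctr n k i) / 2 ^ n) ^ 2 < (1 / 2) ^ 2 := by linarith
    have h2 := abs_lt.1 (abs_lt_of_sq_lt_sq h1 (by norm_num))
    rw [lt_div_iff₀ hl, div_lt_iff₀ hl, ctr_apply] at h2
    constructor <;> linarith

lemma norm_ctr {n : ℤ} {k : Fin d → ℤ} {x : Sp d} (hx : x ∈ oCube n k) : ‖x - ctr n k‖ ≤ d * 2 ^ n := by
  refine norm_le_cube fun i => ?_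
  have hl : (0:ℝ) < 2 ^ n := by positivity
  have := hx i
  rw [abs_le, ctr_apply]
  constructor <;> linarith

lemma cut_cs (n : ℤ) (k : Fin d → ℤ) {m : ℝ} (hm : 16 ≤ m) : HasCompactSupport (cut n k m) := by
  refine HasCompactSupport.of_support_subset_isCompact (isCompact_closedBall (ctr n k) (d * 2 ^ n)) ?_
  intro x hx
  rw [mem_closedBall, dist_eq_norm]
  exact norm_ctr (cut_supp n k hm (subset_tsupport _ hx))

lemma cut_lim (n : ℤ) (k : Fin d → ℤ) {x : Sp d} (hx : x ∈ oCube n k) :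
    Tendsto (fun m : ℕ => cut n k ((m : ℝ) + 16) x) atTop (𝓝 1) := by
  have hl : (0:ℝ) < 2 ^ n := by positivity
  have : ∀ i, ∀ᶠ m : ℕ in atTop, cut1 n k ((m : ℝ) + 16) i x = 1 := by
    intro i
    have h1 : 0 < 1 / 4 - ((x i - ctr n k i) / 2 ^ n) ^ 2 := by
      have h2 : |(x i - ctr n k i) / 2 ^ n| < 1 / 2 := by
        rw [abs_lt, lt_div_iff₀ hl, div_lt_iff₀ hl, ctr_apply]
        have := hx i
        constructor <;> linarith
      have := sq_lt_sq' (by linarith [abs_lt.1 h2]) (abs_lt.1 h2).2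
      linarith
    set q := 1 / 4 - ((x i - ctr n k i) / 2 ^ n) ^ 2
    have ht : Tendsto (fun m : ℕ => (m:ℝ) * q) atTop atTop :=
      tendsto_natCast_atTop_atTop.atTop_mul_const h1
    filter_upwards [ht.eventually_ge_atTop 2] with m hm
    refine Real.smoothTransition.one_of_one_le ?_
    change 1 ≤ ((m:ℝ) + 16) * q - 1
    nlinarith
  refine tendsto_const_nhds.congr' ?_
  filter_upwards [eventually_all.2 this] with m hm
  simp [cut, hm]

lemma trace {E : Set (Sp d)} (hE : MeasurableSet E) (n : ℤ) (k : Fin d → ℤ)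
    (hP : Per E (oCube n k) ≠ ⊤) {φ : Sp d → Sp d} (hφ : ContDiff ℝ 1 φ) (hc : HasCompactSupport φ)
    (hn : ∀ x, ‖φ x‖ ≤ 1) :
    |∫ x in dyadCube n k \ E, divg φ x| ≤ (4 * d + 1) * (Per E (oCube n k)).toReal +
      4 * d * (volume.real (dyadCube n k \ E) / 2 ^ n) := by
  have hl : (0:ℝ) < 2 ^ n := by positivity
  have hPc : Per Eᶜ (oCube n k) ≠ ⊤ := by rwa [Per_compl hE]
  have hstep : ∀ m : ℕ, |∫ x in Eᶜ, cut n k ((m:ℝ) + 16) x * divg φ x| ≤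
      (4 * d + 1) * (Per E (oCube n k)).toReal + 4 * d * (volume.real (dyadCube n k \ E) / 2 ^ n) := by
    intro m
    have hm : (16:ℝ) ≤ (m:ℝ) + 16 := by linarith [Nat.cast_nonneg (α := ℝ) m]
    set η := cut n k ((m:ℝ) + 16) with hη
    have hηd : ContDiff ℝ 1 η := cut_contDiff _ _ _
    have hηc : HasCompactSupport η := cut_cs n k hm
    have hηs : tsupport η ⊆ oCube n k := cut_supp n k hm
    have hη01 : ∀ x, η x ∈ Icc (0:ℝ) 1 := cut_mem n k _
    have hgrad := cut_grad n k hm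
    rw [← hη] at hgrad
    have hψd : ContDiff ℝ 1 (fun x : Sp d => x - ctr n k) := by fun_prop
    have T1 : Tst (oCube n k) (fun x => η x • φ x) :=
      ⟨hηd.smul hφ, hηc.smul_right, (closure_mono (Function.support_smul_subset_left η φ)).trans hηs⟩
    have T2 : Tst (oCube n k) (fun x => η x • (x - ctr n k)) :=
      ⟨hηd.smul hψd, hηc.smul_right, (closure_mono (Function.support_smul_subset_left η _)).trans hηs⟩
    have b1 := abs_int_le_Per hE.compl hPc T1 zero_le_one (fun x => by
      rw [norm_smul, Real.norm_of_nonneg (hη01 x).1]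
      exact mul_le_one₀ (hη01 x).2 (norm_nonneg _) (hn x))
    have b2 := abs_int_le_Per hE.compl hPc T2 (M := d * 2 ^ n) (by positivity) (fun x => by
      by_cases hx : x ∈ oCube n k
      · rw [norm_smul, Real.norm_of_nonneg (hη01 x).1]
        calc η x * ‖x - ctr n k‖ ≤ 1 * (d * 2 ^ n) :=
              mul_le_mul (hη01 x).2 (norm_ctr hx) (norm_nonneg _) zero_le_one
          _ = _ := one_mul _
      · have : η x = 0 := image_eq_zero_of_notMem_tsupport fun h => hx (hηs h)
        rw [this, zero_smul, norm_zero]; positivity)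
    rw [Per_compl hE] at b1 b2
    have dv : ∀ x, divg (fun x : Sp d => x - ctr n k) x = d := by
      intro x
      unfold divg
      have : fderiv ℝ (fun x : Sp d => x - ctr n k) x = ContinuousLinearMap.id ℝ _ := by
        rw [fderiv_sub_const]; exact fderiv_fun_id
      rw [this]; simp
    have e1 : ∀ x, divg (fun x => η x • φ x) x = η x * divg φ x + fderiv ℝ η x (φ x) := fun x =>
      divg_smul (hηd.differentiable one_ne_zero x) (hφ.differentiable one_ne_zero x)
    have e2 : ∀ x, divg (fun x => η x • (x - ctr n k)) x = η x * d + fderiv ℝ η x (x - ctr n k) := fun x => by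
      rw [divg_smul (hηd.differentiable one_ne_zero x) (hψd.differentiable one_ne_zero x), dv]
    have i0 : Integrable (fun x => η x * divg φ x) := by
      refine Continuous.integrable_of_hasCompactSupport (hηd.continuous.mul (continuous_divg hφ)) ?_
      exact hηc.mul_right
    have i1 : Integrable (fun x => fderiv ℝ η x (φ x)) := by
      have := (integrable_divg T1.cd T1.cs).sub i0
      refine this.congr (Eventually.of_forall fun x => ?_)
      simp [e1]
    have i2 : Integrable η := hηd.continuous.integrable_of_hasCompactSupport hηc
    have i3 : Integrable (fun x => fderiv ℝ η x (x - ctr n k)) := by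
      have := (integrable_divg T2.cd T2.cs).sub (i2.mul_const d)
      refine this.congr (Eventually.of_forall fun x => ?_)
      simp [e2]
    simp only [e1, e2] at b1 b2
    rw [integral_add i0.integrableOn i1.integrableOn] at b1
    rw [integral_add (i2.mul_const d).integrableOn i3.integrableOn, integral_mul_const] at b2
    have b3 : |∫ x in Eᶜ, fderiv ℝ η x (φ x)| ≤ -(4 / 2 ^ n) * ∫ x in Eᶜ, fderiv ℝ η x (x - ctr n k) := by
      rw [← integral_const_mul]
      refine (abs_integral_le_integral_abs).trans (integral_mono i1.integrableOn.abs
        (i3.integrableOn.const_mul _) fun x => hgrad x (φ x) (hn x))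
    have b4 : ∫ x in Eᶜ, η x ≤ volume.real (dyadCube n k \ E) := by
      have e : dyadCube n k \ E = Eᶜ ∩ dyadCube n k := by rw [sdiff_eq, inter_comm]
      have : ∫ x in Eᶜ, η x ≤ ∫ x in Eᶜ, (dyadCube n k).indicator (fun _ => (1:ℝ)) x := by
        refine integral_mono i2.integrableOn ?_ fun x => ?_
        · refine Integrable.integrableOn ?_
          exact (integrable_indicator_iff (meas_dyad n k)).2
            (integrableOn_const (by rw [vol_dyad]; finiteness) (by simp))
        · by_cases hx : x ∈ dyadCube n k
          · simpa [hx] using (hη01 x).2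
          · have : η x = 0 := image_eq_zero_of_notMem_tsupport fun h => hx (oCube_sub _ _ (hηs h))
            simp [hx, this]
      refine this.trans_eq ?_
      rw [setIntegral_indicator (meas_dyad n k), ← e]
      simp
    have b5 : 0 ≤ ∫ x in Eᶜ, η x := integral_nonneg fun x => (hη01 x).1
    set I := ∫ x in Eᶜ, η x
    set J := ∫ x in Eᶜ, fderiv ℝ η x (x - ctr n k)
    set p := (Per E (oCube n k)).toReal
    set w := volume.real (dyadCube n k \ E)
    have b6 : -J ≤ d * w + d * 2 ^ n * p := by
      have := (abs_le.1 b2).1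
      have h5 : I * d ≤ w * d := by gcongr
      linarith
    have b7 : -(4 / 2 ^ n) * J ≤ (4 / 2 ^ n) * (d * w + d * 2 ^ n * p) := by
      rw [neg_mul, ← mul_neg]; gcongr
    have e8 : (4 / (2:ℝ) ^ n) * (d * w + d * 2 ^ n * p) = 4 * d * (w / 2 ^ n) + 4 * d * p := by
      field_simp
    have b9 := abs_le.1 b1
    have b10 := abs_le.1 (b3.trans (b7.trans_eq e8))
    rw [abs_le]
    constructor <;> linarith
  have hlim : Tendsto (fun m : ℕ => ∫ x in Eᶜ, cut n k ((m:ℝ) + 16) x * divg φ x) atTop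
      (𝓝 (∫ x in Eᶜ, (oCube n k).indicator (divg φ) x)) := by
    refine tendsto_integral_of_dominated_convergence (fun x => |divg φ x|) (fun m => ?_)
      (integrable_divg hφ hc).integrableOn.abs (fun m => ?_) ?_
    · exact ((cut_contDiff n k _).continuous.mul (continuous_divg hφ)).aestronglyMeasurable
    · refine Eventually.of_forall fun x => ?_
      rw [Real.norm_eq_abs, abs_mul, abs_of_nonneg (cut_mem n k _ x).1]
      exact mul_le_of_le_one_left (abs_nonneg _) (cut_mem n k _ x).2
    · refine Eventually.of_forall fun x => ?_
      by_cases hx : x ∈ oCube n k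
      · rw [indicator_of_mem hx]
        simpa using (cut_lim n k hx).mul_const (divg φ x)
      · rw [indicator_of_notMem hx]
        refine tendsto_const_nhds.congr fun m => ?_
        have hm : (16:ℝ) ≤ (m:ℝ) + 16 := by linarith [Nat.cast_nonneg (α := ℝ) m]
        rw [image_eq_zero_of_notMem_tsupport (fun h => hx (cut_supp n k hm h)), zero_mul]
  have e : ∫ x in Eᶜ, (oCube n k).indicator (divg φ) x = ∫ x in dyadCube n k \ E, divg φ x := by
    rw [setIntegral_indicator (isOpen_oCube n k).measurableSet]
    refine setIntegral_congr_set ?_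
    rw [sdiff_eq, inter_comm]
    exact (o_ae_dyad n k).inter (ae_eq_refl _)
  rw [← e]
  exact le_of_tendsto hlim.abs (Eventually.of_forall hstep)

noncomputable def cT (d : ℕ) : ℝ := (4 * d + 1) + 4 * d * (8 * cP d)

lemma cT_pos (d : ℕ) : 0 < cT d := by
  have := cP_nonneg d
  unfold cT; positivity

lemma trace_le {E : Set (Sp d)} (hd : 1 ≤ d) (hE : MeasurableSet E)
    (n : ℤ) (k : Fin d → ℤ) (hP : Per E (oCube n k) ≠ ⊤) {t : ℝ} (ht0 : 0 < t) (ht1 : t ≤ 1)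
    (h : t * ((2:ℝ) ^ n) ^ d < volume.real (E ∩ dyadCube n k))
    {φ : Sp d → Sp d} (hφ : ContDiff ℝ 1 φ) (hc : HasCompactSupport φ)
    (hn : ∀ x, ‖φ x‖ ≤ 1) :
    |∫ x in dyadCube n k \ E, divg φ x| ≤ cT d * t ^ ((1:ℝ) / d - 1) * (Per E (oCube n k)).toReal := by
  have h1 := trace hE n k hP hφ hc hn
  have h2 := sdiff_bound hd hE n k hP ht0 ht1 h
  have hd0 : (0:ℝ) < d := by exact_mod_cast hd
  have hexp : (1:ℝ) / d - 1 ≤ 0 := by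
    rw [sub_nonpos, div_le_one hd0]; exact_mod_cast hd
  have ht2 : 1 ≤ t ^ ((1:ℝ) / d - 1) := Real.one_le_rpow_of_pos_of_le_one_of_nonpos ht0 ht1 hexp
  set p := (Per E (oCube n k)).toReal
  have hp : 0 ≤ p := ENNReal.toReal_nonneg
  set τ := t ^ ((1:ℝ) / d - 1)
  have h3 : (4 * (d:ℝ) + 1) * 1 * p ≤ (4 * d + 1) * τ * p := by gcongr
  have h4 : 4 * (d:ℝ) * (volume.real (dyadCube n k \ E) / 2 ^ n) ≤ 4 * d * (8 * cP d * τ * p) := by gcongr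
  unfold cT
  linarith

end DM

namespace DM
open scoped Topology
variable {d : ℕ}

lemma layer {g : Sp d → ℝ} (hg : Measurable g) (h0 : ∀ x, 0 ≤ g x) (h1 : ∀ x, g x ≤ 1)
    {ψ : Sp d → ℝ} (hψ : Integrable ψ) {B : ℝ → ℝ} (hB : IntegrableOn B (Ioo 0 1))
    (H : ∀ t ∈ Ioo (0:ℝ) 1, ∫ x in {x | t < g x}, ψ x ≤ B t) :
    ∫ x, g x * ψ x ≤ ∫ t in Ioo (0:ℝ) 1, B t := by
  have hms : MeasurableSet {p : Sp d × ℝ | p.2 < g p.1} :=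
    measurableSet_lt measurable_snd (hg.comp measurable_fst)
  have hprod : Integrable (fun p : Sp d × ℝ => {p : Sp d × ℝ | p.2 < g p.1}.indicator
      (fun p => ψ p.1) p) (volume.prod (volume.restrict (Ioo (0:ℝ) 1))) := by
    refine Integrable.indicator ?_ hms
    exact hψ.comp_fst _
  have e1 : ∀ x, ∫ t in Ioo (0:ℝ) 1, {p : Sp d × ℝ | p.2 < g p.1}.indicator (fun p => ψ p.1) (x, t) =
      g x * ψ x := by
    intro x
    have : (fun t : ℝ => {p : Sp d × ℝ | p.2 < g p.1}.indicator (fun p => ψ p.1) (x, t)) =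
        (Iio (g x)).indicator (fun _ => ψ x) := by
      ext t
      simp [indicator]
    rw [this, setIntegral_indicator measurableSet_Iio, setIntegral_const]
    have : Ioo (0:ℝ) 1 ∩ Iio (g x) = Ioo 0 (g x) := by
      ext t; simp only [mem_inter_iff, mem_Ioo, mem_Iio]
      exact ⟨fun h => ⟨h.1.1, h.2⟩, fun h => ⟨⟨h.1, h.2.trans_le (h1 x)⟩, h.2⟩⟩
    rw [this]
    simp [h0 x]
  have e2 : ∀ t : ℝ, ∫ x, {p : Sp d × ℝ | p.2 < g p.1}.indicator (fun p => ψ p.1) (x, t) =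
      ∫ x in {x | t < g x}, ψ x := by
    intro t
    have hmt : MeasurableSet {x | t < g x} := measurableSet_lt measurable_const hg
    rw [← integral_indicator hmt]
    rfl
  calc ∫ x, g x * ψ x = ∫ x, ∫ t in Ioo (0:ℝ) 1,
        {p : Sp d × ℝ | p.2 < g p.1}.indicator (fun p => ψ p.1) (x, t) := by simp_rw [e1]
    _ = ∫ t in Ioo (0:ℝ) 1, ∫ x, {p : Sp d × ℝ | p.2 < g p.1}.indicator (fun p => ψ p.1) (x, t) :=
        integral_integral_swap hprod
    _ ≤ ∫ t in Ioo (0:ℝ) 1, B t := by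
        refine setIntegral_mono_on hprod.integral_prod_right hB measurableSet_Ioo fun t ht => ?_
        rw [e2]; exact H t ht

abbrev Ix (d : ℕ) := ℤ × (Fin d → ℤ)

def Q (q : Ix d) : Set (Sp d) := dyadCube q.1 q.2

open Classical in
lemma exists_max_disj (S : Finset (Ix d)) : ∃ T ⊆ S, (⋃ q ∈ S, Q q) = ⋃ q ∈ T, Q q ∧
    (T : Set (Ix d)).PairwiseDisjoint Q := by
  refine ⟨S.filter fun q => ∀ q' ∈ S, (Q q ∩ Q q').Nonempty → q'.1 ≤ q.1, Finset.filter_subset _ _, ?_, ?_⟩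
  · refine subset_antisymm ?_ (biUnion_subset_biUnion_left (Finset.filter_subset _ _))
    intro x hx
    obtain ⟨q, hq, hxq⟩ := mem_iUnion₂.1 hx
    obtain ⟨q', hq', hmax⟩ := (S.filter fun q => x ∈ Q q).exists_max_image (fun q => q.1)
      ⟨q, Finset.mem_filter.2 ⟨hq, hxq⟩⟩
    rw [Finset.mem_filter] at hq'
    refine mem_iUnion₂.2 ⟨q', Finset.mem_filter.2 ⟨hq'.1, fun q'' hq'' ⟨y, hy1, hy2⟩ => ?_⟩, hq'.2⟩
    by_contra hcon
    push Not at hcon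
    have := hmax q'' (Finset.mem_filter.2 ⟨hq'', nested hcon.le hy1 hy2 hq'.2⟩)
    linarith
  · intro q hq q' hq' hne
    rw [Finset.mem_coe, Finset.mem_filter] at hq hq'
    refine disjoint_left.2 fun x hx hx' => hne ?_
    have h1 := hq.2 q' hq'.1 ⟨x, hx, hx'⟩
    have h2 := hq'.2 q hq.1 ⟨x, hx', hx⟩
    have h3 : q.1 = q'.1 := le_antisymm h2 h1
    refine Prod.ext h3 ?_
    have h4 := mem_dyad_iff.1 hx
    have h5 := mem_dyad_iff.1 hx'
    rw [← h4, ← h5, h3]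

lemma level {E Ω : Set (Sp d)} (hd : 1 ≤ d) (hE : MeasurableSet E) (hP : Per E Ω ≠ ⊤)
    {φ : Sp d → Sp d} (hφ : Tst Ω φ) (hn : ∀ x, ‖φ x‖ ≤ 1) {t : ℝ} (ht0 : 0 < t) (ht1 : t ≤ 1)
    (S : Finset (Ix d)) (hS : ∀ q ∈ S, Q q ⊆ Ω)
    (hSt : ∀ q ∈ S, t * ((2:ℝ) ^ q.1) ^ d < volume.real (E ∩ Q q)) :
    ∫ x in E ∪ ⋃ q ∈ S, Q q, divg φ x ≤ (1 + cT d * t ^ ((1:ℝ) / d - 1)) * (Per E Ω).toReal := by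
  obtain ⟨T, hTS, hU, hdisj⟩ := exists_max_disj S
  have hint := integrable_divg hφ.cd hφ.cs
  have e : E ∪ ⋃ q ∈ S, Q q = E ∪ ⋃ q ∈ T, (Q q \ E) := by
    rw [hU]; ext x; simp only [mem_union, mem_iUnion, Set.mem_sdiff]; by_cases hx : x ∈ E <;> simp [hx]
  have hm : ∀ q ∈ T, MeasurableSet (Q q \ E) := fun q _ => (meas_dyad q.1 q.2).diff hE
  rw [e, setIntegral_union ?_ (Finset.measurableSet_biUnion T hm) hint.integrableOn hint.integrableOn,
    integral_biUnion_finset T hm (hdisj.mono fun q => sdiff_subset) (fun _ _ => hint.integrableOn)]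
  · have h1 := int_le_Per hE hP hφ zero_le_one hn
    have ho : ∀ q ∈ T, oCube q.1 q.2 ⊆ Ω := fun q hq => (oCube_sub _ _).trans (hS q (hTS hq))
    have h2 : ∀ q ∈ T, ∫ x in Q q \ E, divg φ x ≤ cT d * t ^ ((1:ℝ) / d - 1) *
        (Per E (oCube q.1 q.2)).toReal := fun q hq =>
      (le_abs_self _).trans (trace_le hd hE q.1 q.2
        (ne_top_of_le_ne_top hP (Per_mono hE (ho q hq))) ht0 ht1 (hSt q (hTS hq)) hφ.cd hφ.cs hn)
    have h3 := Finset.sum_le_sum h2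
    rw [← Finset.mul_sum] at h3
    have h4 := sum_Per_le_real hE T hP (fun q => oCube q.1 q.2) ho
      (hdisj.mono fun q => oCube_sub _ _)
    have hc := cT_pos d
    have h5 := mul_le_mul_of_nonneg_left h4 (show 0 ≤ cT d * t ^ ((1:ℝ) / d - 1) by positivity)
    linarith
  · rw [disjoint_iUnion₂_right]
    exact fun q _ => disjoint_sdiff_right

noncomputable def th (E : Set (Sp d)) (q : Ix d) : ℝ≥0∞ := volume (E ∩ Q q) / volume (Q q)

lemma th_le (E : Set (Sp d)) (q : Ix d) : th E q ≤ 1 :=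
  ENNReal.div_le_of_le_mul (by rw [one_mul]; exact measure_mono inter_subset_right)

noncomputable def GG (E : Set (Sp d)) (S : Finset (Ix d)) (x : Sp d) : ℝ≥0∞ :=
  E.indicator (fun _ => 1) x ⊔ S.sup fun q => (Q q).indicator (fun _ => th E q) x

lemma GG_le (E : Set (Sp d)) (S : Finset (Ix d)) (x : Sp d) : GG E S x ≤ 1 := by
  refine sup_le (indicator_le_self' (by simp) x |>.trans le_rfl) (Finset.sup_le fun q _ => ?_)
  exact (indicator_le_self' (fun _ _ => zero_le) x).trans (th_le E q)

lemma GG_meas {E : Set (Sp d)} (hE : MeasurableSet E) (S : Finset (Ix d)) : Measurable (GG E S) := by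
  unfold GG
  refine (measurable_const.indicator hE).sup ?_
  simp only [Finset.sup_eq_iSup]
  exact Measurable.iSup fun q => Measurable.iSup fun _ => measurable_const.indicator (meas_dyad q.1 q.2)

open Classical in
lemma partA_fin {E Ω : Set (Sp d)} (hd : 1 ≤ d) (hE : MeasurableSet E) (hP : Per E Ω ≠ ⊤)
    {φ : Sp d → Sp d} (hφ : Tst Ω φ) (hn : ∀ x, ‖φ x‖ ≤ 1)
    (S : Finset (Ix d)) (hS : ∀ q ∈ S, Q q ⊆ Ω) :
    ∫ x, (GG E S x).toReal * divg φ x ≤ (1 + cT d * d) * (Per E Ω).toReal := by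
  have hd0 : (0:ℝ) < d := by exact_mod_cast hd
  have hexp : -1 < (1:ℝ) / d - 1 := by have : 0 < (1:ℝ)/d := by positivity
                                       linarith
  have hi : IntegrableOn (fun t : ℝ => t ^ ((1:ℝ) / d - 1)) (Ioo 0 1) :=
    (intervalIntegral.integrableOn_Ioo_rpow_iff zero_lt_one).2 hexp
  have hB : IntegrableOn (fun t : ℝ => (1 + cT d * t ^ ((1:ℝ) / d - 1)) * (Per E Ω).toReal) (Ioo 0 1) := by
    refine Integrable.mul_const (Integrable.add ?_ (hi.const_mul _)) _
    exact integrableOn_const (by simp) (by simp)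
  have h := layer (g := fun x => (GG E S x).toReal) (GG_meas hE S).ennreal_toReal
    (fun x => ENNReal.toReal_nonneg) (fun x => ENNReal.toReal_le_of_le_ofReal zero_le_one (by simpa using GG_le E S x))
    (integrable_divg hφ.cd hφ.cs) hB (fun t ht => ?_)
  · refine h.trans_eq ?_
    have hi1 : Integrable (fun _ : ℝ => (1:ℝ)) (volume.restrict (Ioo (0:ℝ) 1)) :=
      integrableOn_const (by simp) (by simp)
    rw [integral_mul_const, integral_add hi1 (hi.const_mul _),
      integral_const_mul, ← integral_Ioc_eq_integral_Ioo (f := fun t : ℝ => t ^ ((1:ℝ) / d - 1)),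
      ← intervalIntegral.integral_of_le zero_le_one, integral_rpow (Or.inl hexp)]
    congr 1
    simp
    left
    rw [Real.zero_rpow (by positivity)]
    simp
  · have e : {x | t < (GG E S x).toReal} = E ∪ ⋃ q ∈ S.filter (fun q => ENNReal.ofReal t < th E q), Q q := by
      ext x
      rw [mem_ofPred_eq, ← ENNReal.ofReal_lt_iff_lt_toReal ht.1.le
        (ne_top_of_le_ne_top ENNReal.one_ne_top (GG_le E S x))]
      unfold GG
      rw [lt_sup_iff, Finset.lt_sup_iff, mem_union, mem_iUnion₂]
      refine or_congr ?_ ⟨?_, ?_⟩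
      · by_cases hx : x ∈ E
        · simp [hx, ht.2]
        · simp [hx]
      · rintro ⟨q, hq, h⟩
        by_cases hx : x ∈ Q q
        · rw [indicator_of_mem hx] at h
          exact ⟨q, Finset.mem_filter.2 ⟨hq, h⟩, hx⟩
        · rw [indicator_of_notMem hx] at h
          simp at h
      · rintro ⟨q, hq, hx⟩
        rw [Finset.mem_filter] at hq
        exact ⟨q, hq.1, by rw [indicator_of_mem hx]; exact hq.2⟩
    rw [e]
    refine level hd hE hP hφ hn ht.1 ht.2.le _ (fun q hq => hS q (Finset.mem_filter.1 hq).1) fun q hq => ?_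
    have h2 := (Finset.mem_filter.1 hq).2
    have hv : volume (Q q) = ENNReal.ofReal (((2:ℝ) ^ q.1) ^ d) := vol_dyad _ _
    unfold th at h2
    rw [ENNReal.lt_div_iff_mul_lt (Or.inl (by rw [hv]; simp; positivity)) (Or.inl (by rw [hv]; finiteness)), hv,
      ← ENNReal.ofReal_mul ht.1.le] at h2
    exact (ENNReal.ofReal_lt_iff_lt_toReal (by have := ht.1; positivity) (fin_inter_dyad _ _ _)).1 h2

lemma dyadMax_eq (Ω E : Set (Sp d)) (x : Sp d) :
    dyadMax Ω E x = ⨆ (q : Ix d) (_ : x ∈ Q q) (_ : Q q ⊆ Ω), th E q := by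
  unfold dyadMax th Q
  rw [iSup_prod]

lemma dyadMax_le (Ω E : Set (Sp d)) (x : Sp d) : dyadMax Ω E x ≤ 1 := by
  rw [dyadMax_eq]
  exact iSup_le fun q => iSup_le fun _ => iSup_le fun _ => th_le E q

lemma dyadMax_ae {Ω E : Set (Sp d)} (hΩ : IsOpen Ω) (hE : MeasurableSet E) :
    ∀ᵐ x, x ∈ Ω → x ∈ E → dyadMax Ω E x = 1 := by
  filter_upwards [density hE] with x hx hxΩ hxE
  refine le_antisymm (dyadMax_le _ _ _) ?_
  obtain ⟨r, hr, hball⟩ := Metric.isOpen_iff.1 hΩ x hxΩ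
  refine le_of_tendsto (hx hxE) ?_
  have ht : Tendsto (fun j : ℕ => (d:ℝ) * (2:ℝ) ^ (-(j:ℤ))) atTop (𝓝 (d * 0)) := by
    refine Tendsto.const_mul _ ?_
    simp only [zpow_neg, zpow_natCast]
    exact tendsto_inv_atTop_zero.comp (tendsto_pow_atTop_atTop_of_one_lt one_lt_two)
  rw [mul_zero] at ht
  filter_upwards [ht.eventually_lt_const hr] with j hj
  rw [dyadMax_eq]
  refine le_iSup_of_le (-(j:ℤ), idx (-(j:ℤ)) x) (le_iSup_of_le (mem_idx _ x) (le_iSup_of_le ?_ le_rfl))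
  intro y hy
  refine hball ?_
  rw [mem_ball, dist_eq_norm]
  exact (diam_cCube (dyad_sub_cCube _ _ (mem_idx _ x)) (dyad_sub_cCube _ _ hy)).trans_lt hj

open Classical in
lemma partA {E Ω : Set (Sp d)} (hd : 1 ≤ d) (hE : MeasurableSet E) (hΩ : IsOpen Ω) :
    var Ω (fun x => (dyadMax Ω E x).toReal) ≤ ENNReal.ofReal (1 + cT d * d) * Per E Ω := by
  have hc := cT_pos d
  by_cases hP : Per E Ω = ⊤
  · rw [hP, ENNReal.mul_top (by simp; positivity)]; exact le_top
  unfold var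
  refine iSup_le fun φ => iSup_le fun h1 => iSup_le fun h2 => iSup_le fun h3 => iSup_le fun hn => ?_
  have hφ : Tst Ω φ := ⟨h1, h2, h3⟩
  have hint := integrable_divg h1 h2
  obtain ⟨e, he⟩ := exists_surjective_nat (Ix d)
  set S : ℕ → Finset (Ix d) := fun N => ((Finset.range N).image e).filter (fun q => Q q ⊆ Ω) with hS
  have hmono : Monotone S := fun a b hab => Finset.filter_subset_filter _
    (Finset.image_subset_image (Finset.range_subset_range.2 hab))
  have hlim : ∀ᵐ x ∂(volume.restrict Ω), Tendsto (fun N => (GG E (S N) x).toReal) atTop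
      (𝓝 (dyadMax Ω E x).toReal) := by
    rw [ae_restrict_iff' hΩ.measurableSet]
    filter_upwards [dyadMax_ae hΩ hE] with x hx hxΩ
    have hm : Monotone (fun N => GG E (S N) x) := fun a b hab =>
      sup_le_sup le_rfl (Finset.sup_mono (hmono hab))
    have hs : ⨆ N, GG E (S N) x = dyadMax Ω E x := by
      refine le_antisymm (iSup_le fun N => sup_le ?_ (Finset.sup_le fun q hq => ?_)) ?_
      · by_cases hxE : x ∈ E
        · rw [hx hxΩ hxE]; simp [hxE]
        · simp [hxE]
      · by_cases hxq : x ∈ Q q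
        · rw [indicator_of_mem hxq, dyadMax_eq]
          exact le_iSup_of_le q (le_iSup_of_le hxq (le_iSup_of_le (Finset.mem_filter.1 hq).2 le_rfl))
        · simp [hxq]
      · rw [dyadMax_eq]
        refine iSup_le fun q => iSup_le fun hxq => iSup_le fun hqΩ => ?_
        obtain ⟨N, rfl⟩ := he q
        refine le_iSup_of_le (N+1) (le_sup_of_le_right ?_)
        have hmem : e N ∈ S (N+1) := Finset.mem_filter.2
          ⟨Finset.mem_image_of_mem e (Finset.self_mem_range_succ N), hqΩ⟩
        refine le_trans ?_ (Finset.le_sup (f := fun q => (Q q).indicator (fun _ => th E q) x) hmem)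
        rw [indicator_of_mem hxq]
    have h := tendsto_atTop_iSup hm
    rw [hs] at h
    exact (ENNReal.tendsto_toReal (ne_top_of_le_ne_top ENNReal.one_ne_top (dyadMax_le _ _ _))).comp h
  have hD : Tendsto (fun N => ∫ x in Ω, (GG E (S N) x).toReal * divg φ x) atTop
      (𝓝 (∫ x in Ω, (dyadMax Ω E x).toReal * divg φ x)) := by
    refine tendsto_integral_of_dominated_convergence (fun x => |divg φ x|) (fun N => ?_)
      hint.integrableOn.abs (fun N => ?_) ?_
    · exact ((GG_meas hE _).ennreal_toReal.mul (continuous_divg h1).measurable).aestronglyMeasurable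
    · refine Eventually.of_forall fun x => ?_
      rw [Real.norm_eq_abs, abs_mul, abs_of_nonneg ENNReal.toReal_nonneg]
      exact mul_le_of_le_one_left (abs_nonneg _)
        (ENNReal.toReal_le_of_le_ofReal zero_le_one (by simpa using GG_le E _ x))
    · filter_upwards [hlim] with x hx
      exact hx.mul_const _
  have hle : ∫ x in Ω, (dyadMax Ω E x).toReal * divg φ x ≤ (1 + cT d * d) * (Per E Ω).toReal := by
    refine le_of_tendsto hD (Eventually.of_forall fun N => ?_)
    have := partA_fin hd hE hP hφ hn (S N) (fun q hq => (Finset.mem_filter.1 hq).2)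
    rw [setIntegral_eq_integral_of_forall_compl_eq_zero]
    · exact this
    · intro x hx
      rw [divg_zero_of_notMem fun h => hx (h3 h), mul_zero]
  calc _ ≤ ENNReal.ofReal ((1 + cT d * d) * (Per E Ω).toReal) := ENNReal.ofReal_le_ofReal hle
    _ = _ := by rw [ENNReal.ofReal_mul (by positivity), ENNReal.ofReal_toReal hP]

end DM

namespace DM
open scoped Topology
variable {d : ℕ}

lemma int_split {E : Set (Sp d)} {φ : Sp d → Sp d} (hφ : ContDiff ℝ 1 φ)
    (hc : HasCompactSupport φ) {χ : Sp d → ℝ} (hχ : ContDiff ℝ 1 χ) :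
    ∫ x in E, divg φ x = (∫ x in E, divg (fun x => χ x • φ x) x) +
      ∫ x in E, divg (fun x => (1 - χ x) • φ x) x := by
  have hχ' : ContDiff ℝ 1 (fun x => 1 - χ x) := contDiff_const.sub hχ
  have T : Tst univ φ := ⟨hφ, hc, subset_univ _⟩
  have T1 := T.smul hχ
  have T2 := T.smul hχ'
  rw [← integral_add (integrable_divg T1.cd T1.cs).integrableOn
    (integrable_divg T2.cd T2.cs).integrableOn]
  congr 1
  ext x
  rw [← divg_add (T1.cd.differentiable one_ne_zero x) (T2.cd.differentiable one_ne_zero x)]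
  congr 1
  ext x : 1
  rw [← add_smul]; simp

lemma Per_union_le {E U V : Set (Sp d)} (hE : MeasurableSet E) (hU : IsOpen U) (hV : IsOpen V) :
    Per E (U ∪ V) ≤ Per E U + Per E V := by
  refine Per_le hE fun φ hφ hn => ?_
  have hK : IsCompact (tsupport φ \ U) := hφ.cs.isCompact.diff hU
  obtain ⟨L, hL, hKL, hLV⟩ := exists_compact_between hK hV (by
    rintro x ⟨hx, hxU⟩
    exact (hφ.ts hx).resolve_left hxU)
  obtain ⟨ψ, h1, h2, h3, h4, h5⟩ := exists_cutoff hL hV hLV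
  have hχ' : ContDiff ℝ 1 (fun x => 1 - ψ x) := contDiff_const.sub h1
  have T1 : Tst V (fun x => ψ x • φ x) :=
    ⟨(hφ.smul h1).cd, (hφ.smul h1).cs, (closure_mono (Function.support_smul_subset_left ψ φ)).trans h3⟩
  have T2 : Tst U (fun x => (1 - ψ x) • φ x) := by
    refine ⟨(hφ.smul hχ').cd, (hφ.smul hχ').cs, ?_⟩
    have hs1 : tsupport (fun x => (1 - ψ x) • φ x) ⊆ tsupport φ :=
      closure_mono (Function.support_smul_subset_right (fun x => 1 - ψ x) φ)
    have hs2 : tsupport (fun x => (1 - ψ x) • φ x) ⊆ (interior L)ᶜ := by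
      refine closure_minimal ?_ isOpen_interior.isClosed_compl
      intro x hx hxL
      refine hx ?_
      simp [h4 x (interior_subset hxL)]
    intro x hx
    by_contra hxU
    exact hs2 hx (hKL ⟨hs1 hx, hxU⟩)
  rw [int_split hφ.cd hφ.cs h1, add_comm (Per E U)]
  refine ENNReal.ofReal_add_le.trans (add_le_add (le_Per hE T1 fun x => ?_) (le_Per hE T2 fun x => ?_))
  · rw [norm_smul, Real.norm_of_nonneg (h5 x).1]
    exact mul_le_one₀ (h5 x).2 (norm_nonneg _) (hn x)
  · rw [norm_smul, Real.norm_of_nonneg (by linarith [(h5 x).2])]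
    exact mul_le_one₀ (by linarith [(h5 x).1]) (norm_nonneg _) (hn x)

lemma Per_empty {E : Set (Sp d)} (hE : MeasurableSet E) : Per E ∅ = 0 := by
  refine le_antisymm (Per_le hE fun φ hφ hn => ?_) zero_le
  have : φ = 0 := by
    have := hφ.ts
    rw [subset_empty_iff, tsupport_eq_empty_iff] at this
    exact this
  subst this
  simp [divg_zero_of_notMem]

open Classical in
lemma Per_finset_le {E : Set (Sp d)} (hE : MeasurableSet E) {ι : Type*} (s : Finset ι)
    {U : ι → Set (Sp d)} (hU : ∀ i, IsOpen (U i)) : Per E (⋃ i ∈ s, U i) ≤ ∑ i ∈ s, Per E (U i) := by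
  induction s using Finset.induction_on with
  | empty => simp [Per_empty hE]
  | insert a s ha ih =>
    rw [Finset.set_biUnion_insert, Finset.sum_insert ha]
    exact (Per_union_le hE (hU a) (isOpen_biUnion fun i _ => hU i)).trans
      (add_le_add le_rfl ih)

lemma Per_iUnion_le {E : Set (Sp d)} (hE : MeasurableSet E) {ι : Type*}
    {U : ι → Set (Sp d)} (hU : ∀ i, IsOpen (U i)) : Per E (⋃ i, U i) ≤ ∑' i, Per E (U i) := by
  refine Per_le hE fun φ hφ hn => ?_
  obtain ⟨t, ht⟩ := hφ.cs.isCompact.elim_finite_subcover U hU hφ.ts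
  exact (le_Per hE ⟨hφ.cd, hφ.cs, ht⟩ hn).trans ((Per_finset_le hE t hU).trans (ENNReal.sum_le_tsum t))

lemma ball_cut (d : ℕ) : ∃ C : ℝ, 0 ≤ C ∧ ∀ (x : Sp d) (r : ℝ), 0 < r → ∃ b : Sp d → ℝ, ContDiff ℝ 1 b ∧
    (∀ y, b y ∈ Icc (0:ℝ) 1) ∧ (∀ y ∈ ball x r, b y = 1) ∧ (∀ y ∉ ball x (2 * r), b y = 0) ∧
    ∀ y v, |fderiv ℝ b y v| ≤ C / r * ‖v‖ := by
  let f : ContDiffBump (0 : Sp d) := ⟨1, 2, by norm_num, by norm_num⟩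
  have hf : ContDiff ℝ 1 f := f.contDiff
  obtain ⟨C, hC⟩ := (f.hasCompactSupport.fderiv (𝕜 := ℝ)).exists_bound_of_continuous (hf.continuous_fderiv one_ne_zero)
  refine ⟨C, (norm_nonneg _).trans (hC 0), fun x r hr => ⟨fun y => f (r⁻¹ • (y - x)), ?_, ?_, ?_, ?_, ?_⟩⟩
  · exact hf.comp (by fun_prop)
  · exact fun y => ⟨f.nonneg, f.le_one⟩
  · intro y hy
    refine f.one_of_mem_closedBall ?_
    rw [mem_ball, dist_eq_norm] at hy
    rw [mem_closedBall_zero_iff, norm_smul, norm_inv, Real.norm_of_nonneg hr.le]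
    change _ ≤ (1:ℝ)
    rw [inv_mul_le_iff₀ hr]; linarith
  · intro y hy
    refine f.zero_of_le_dist ?_
    rw [mem_ball, dist_eq_norm, not_lt] at hy
    rw [dist_zero_right, norm_smul, norm_inv, Real.norm_of_nonneg hr.le]
    change (2:ℝ) ≤ _
    rw [le_inv_mul_iff₀ hr]; linarith
  · intro y v
    have h1 : HasFDerivAt (fun y : Sp d => r⁻¹ • (y - x)) (r⁻¹ • ContinuousLinearMap.id ℝ (Sp d)) y :=
      ((hasFDerivAt_id y).sub_const x).const_smul r⁻¹
    have h2 := (hf.differentiable one_ne_zero (r⁻¹ • (y - x))).hasFDerivAt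
    have h3 := h2.comp y h1
    have h4 : fderiv ℝ (fun y => f (r⁻¹ • (y - x))) y = _ := h3.fderiv
    rw [h4]
    simp only [ContinuousLinearMap.comp_apply, smul_apply, ContinuousLinearMap.id_apply, map_smul, smul_eq_mul, abs_mul]
    rw [abs_of_pos (inv_pos.2 hr), div_eq_inv_mul, mul_assoc]
    gcongr
    rw [← Real.norm_eq_abs]
    exact ContinuousLinearMap.le_of_opNorm_le _ (hC _) v

lemma cut_balls (d : ℕ) : ∃ C : ℝ, 0 ≤ C ∧ ∀ (E G : Set (Sp d)), MeasurableSet E → Per E G ≠ ⊤ →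
    ∀ (φ : Sp d → Sp d), ContDiff ℝ 1 φ → HasCompactSupport φ → (∀ x, ‖φ x‖ ≤ 1) →
    ∀ M : ℝ, 0 ≤ M → (∀ x, |divg φ x| ≤ M) → ∀ {ι : Type} (s : Finset ι) (c : ι → Sp d) (r : ι → ℝ),
    (∀ i ∈ s, 0 < r i) → (tsupport φ ⊆ G ∪ ⋃ i ∈ s, ball (c i) (r i)) →
    ∫ x in E, divg φ x ≤ (Per E G).toReal +
      ∑ i ∈ s, (C / r i + M) * volume.real (E ∩ ball (c i) (2 * r i)) := by
  classical
  obtain ⟨C, hC0, hC⟩ := ball_cut d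
  refine ⟨C, hC0, fun E G hE hG φ hφ hc hn M hM hdiv ι s c r hr hcov => ?_⟩
  have hC' : ∀ i : ι, ∃ b : Sp d → ℝ, i ∈ s → ContDiff ℝ 1 b ∧
    (∀ y, b y ∈ Icc (0:ℝ) 1) ∧ (∀ y ∈ ball (c i) (r i), b y = 1) ∧ (∀ y ∉ ball (c i) (2 * r i), b y = 0) ∧
    ∀ y v, |fderiv ℝ b y v| ≤ C / r i * ‖v‖ := by
    intro i
    by_cases hi : i ∈ s
    · obtain ⟨b, hb⟩ := hC (c i) (r i) (hr i hi)
      exact ⟨b, fun _ => hb⟩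
    · exact ⟨0, fun h => absurd h hi⟩
  choose b hb using hC'
  set χ : Sp d → ℝ := fun y => ∏ i ∈ s, (1 - b i y) with hχ
  have hχd : ContDiff ℝ 1 χ := contDiff_prod fun i hi => contDiff_const.sub (hb i hi).1
  have hχ01 : ∀ y, χ y ∈ Icc (0:ℝ) 1 := fun y =>
    ⟨Finset.prod_nonneg fun i hi => by linarith [((hb i hi).2.1 y).2],
      Finset.prod_le_one (fun i hi => by linarith [((hb i hi).2.1 y).2])
        fun i hi => by linarith [((hb i hi).2.1 y).1]⟩
  have T0 : Tst univ φ := ⟨hφ, hc, subset_univ _⟩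
  have T1 : Tst G (fun x => χ x • φ x) := by
    refine ⟨(T0.smul hχd).cd, (T0.smul hχd).cs, ?_⟩
    have hs1 : tsupport (fun x => χ x • φ x) ⊆ tsupport φ :=
      closure_mono (Function.support_smul_subset_right χ φ)
    have hs2 : tsupport (fun x => χ x • φ x) ⊆ (⋃ i ∈ s, ball (c i) (r i))ᶜ := by
      refine closure_minimal ?_ (isOpen_biUnion fun i _ => isOpen_ball).isClosed_compl
      intro x hx hxL
      obtain ⟨i, hi, hxi⟩ := mem_iUnion₂.1 hxL
      refine hx ?_
      have : χ x = 0 := Finset.prod_eq_zero hi (by rw [(hb i hi).2.2.1 x hxi, sub_self])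
      simp [this]
    intro x hx
    exact (hcov (hs1 hx)).resolve_right (hs2 hx)
  have b1 := int_le_Per hE hG T1 zero_le_one (fun x => by
    rw [norm_smul, Real.norm_of_nonneg (hχ01 x).1]
    exact mul_le_one₀ (hχ01 x).2 (norm_nonneg _) (hn x))
  have hχ' : ContDiff ℝ 1 (fun x => 1 - χ x) := contDiff_const.sub hχd
  have hfd : ∀ x, HasFDerivAt χ (∑ i ∈ s, (∏ j ∈ s.erase i, (1 - b j x)) • (-fderiv ℝ (b i) x)) x := fun x =>
    HasFDerivAt.finsetProd (fun i hi =>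
      (((hb i hi).1.differentiable one_ne_zero x).hasFDerivAt).const_sub 1)
  have hpt : ∀ x, divg (fun x => (1 - χ x) • φ x) x ≤
      ∑ i ∈ s, (C / r i + M) * (ball (c i) (2 * r i)).indicator (fun _ => (1:ℝ)) x := by
    intro x
    rw [divg_smul (hχ'.differentiable one_ne_zero x) (hφ.differentiable one_ne_zero x)]
    have e : fderiv ℝ (fun x => 1 - χ x) x = -fderiv ℝ χ x := by rw [fderiv_const_sub]
    rw [e, (hfd x).fderiv]
    simp only [neg_apply, sum_apply, smul_apply, smul_eq_mul, add_mul, Finset.sum_add_distrib]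
    rw [add_comm (∑ i ∈ s, _ * _)]
    have hCr : ∀ i ∈ s, 0 ≤ C / r i := fun i hi => by have := hr i hi; positivity
    refine add_le_add ?_ ?_
    · by_cases hx : ∃ i ∈ s, x ∈ ball (c i) (2 * r i)
      · obtain ⟨i, hi, hxi⟩ := hx
        calc (1 - χ x) * divg φ x ≤ 1 * M := by
              refine (le_abs_self _).trans ?_
              rw [abs_mul, abs_of_nonneg (by linarith [(hχ01 x).2])]
              exact mul_le_mul (by linarith [(hχ01 x).1]) (hdiv x) (abs_nonneg _) zero_le_one
          _ = M * (ball (c i) (2 * r i)).indicator (fun _ => (1:ℝ)) x := by rw [indicator_of_mem hxi]; ring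
          _ ≤ _ := Finset.single_le_sum (f := fun i => M * (ball (c i) (2 * r i)).indicator (fun _ => (1:ℝ)) x)
                (fun j _ => mul_nonneg hM (indicator_nonneg (by simp) _)) hi
      · push Not at hx
        have : χ x = 1 := Finset.prod_eq_one fun i hi => by rw [(hb i hi).2.2.2.1 x (hx i hi), sub_zero]
        rw [this, sub_self, zero_mul]
        exact Finset.sum_nonneg fun j _ => mul_nonneg hM (indicator_nonneg (by simp) _)
    · rw [← Finset.sum_neg_distrib]
      refine Finset.sum_le_sum fun i hi => ?_
      have hp : ∏ j ∈ s.erase i, (1 - b j x) ∈ Icc (0:ℝ) 1 :=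
        ⟨Finset.prod_nonneg fun j hj => by linarith [((hb j (Finset.mem_of_mem_erase hj)).2.1 x).2],
        Finset.prod_le_one (fun j hj => by linarith [((hb j (Finset.mem_of_mem_erase hj)).2.1 x).2])
          fun j hj => by linarith [((hb j (Finset.mem_of_mem_erase hj)).2.1 x).1]⟩
      by_cases hx : x ∈ ball (c i) (2 * r i)
      · rw [indicator_of_mem hx, mul_one]
        refine (le_abs_self _).trans ?_
        rw [abs_neg, abs_mul, abs_neg, abs_of_nonneg hp.1]
        have h1 : |fderiv ℝ (b i) x (φ x)| ≤ C / r i := ((hb i hi).2.2.2.2 x (φ x)).trans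
          (mul_le_of_le_one_right (hCr i hi) (hn x))
        calc _ ≤ 1 * (C / r i) := mul_le_mul hp.2 h1 (abs_nonneg _) zero_le_one
          _ = _ := one_mul _
      · have hz : fderiv ℝ (b i) x = 0 := by
          refine IsLocalMin.fderiv_eq_zero (Eventually.of_forall fun y => ?_)
          rw [(hb i hi).2.2.2.1 x hx]; exact ((hb i hi).2.1 y).1
        rw [hz, indicator_of_notMem hx]; simp
  have hfin : ∀ i, volume (ball (c i) (2 * r i)) ≠ ⊤ := fun i => measure_ball_lt_top.ne
  have hii : ∀ i ∈ s, IntegrableOn (fun x => (C / r i + M) * (ball (c i) (2 * r i)).indicator (fun _ => (1:ℝ)) x) E :=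
    fun i _ => (((integrable_indicator_iff measurableSet_ball).2
      (integrableOn_const (hfin i) (by simp))).const_mul _).integrableOn
  have b2 : ∫ x in E, divg (fun x => (1 - χ x) • φ x) x ≤
      ∑ i ∈ s, (C / r i + M) * volume.real (E ∩ ball (c i) (2 * r i)) := by
    refine (integral_mono (integrable_divg (T0.smul hχ').cd (T0.smul hχ').cs).integrableOn
      (integrable_finsetSum s hii) hpt).trans_eq ?_
    rw [integral_finsetSum s hii]
    refine Finset.sum_congr rfl fun i hi => ?_
    rw [integral_const_mul, setIntegral_indicator measurableSet_ball]
    simp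
  rw [int_split hφ hc hχd]
  linarith

end DM

namespace DM
open scoped Topology
variable {d : ℕ}

lemma finite_idx {K : Set (Sp d)} (hK : IsCompact K) (n : ℤ) : (idx n '' K).Finite := by
  obtain ⟨R, hR⟩ := hK.isBounded.subset_closedBall (0 : Sp d)
  refine (Set.finite_Icc (fun _ => ⌊-R / 2 ^ n⌋) (fun _ => ⌊R / 2 ^ n⌋)).subset ?_
  rintro _ ⟨x, hx, rfl⟩
  have h1 := hR hx
  rw [mem_closedBall_zero_iff] at h1
  have h2 : ∀ i, |x i| ≤ R := fun i => by
    have := PiLp.norm_apply_le x i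
    rw [Real.norm_eq_abs] at this
    linarith
  refine ⟨fun i => ?_, fun i => ?_⟩
  · exact Int.floor_le_floor (by gcongr; exact (abs_le.1 (h2 i)).1)
  · exact Int.floor_le_floor (by gcongr; exact (abs_le.1 (h2 i)).2)

noncomputable def nb (d : ℕ) : Finset (Fin d → ℤ) :=
  Fintype.piFinset fun _ => Finset.Icc (-(4 * (d:ℤ) + 1)) (4 * d + 1)

noncomputable def c1 (d : ℕ) : ℝ := d * (4 * d + 3)

lemma ball_sub_nbr {n : ℤ} {x y : Sp d} (h : y ∈ ball x (2 * (2 * d * 2 ^ n))) :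
    ∃ m ∈ nb d, y ∈ dyadCube n (idx n x + m) := by
  refine ⟨idx n y - idx n x, ?_, ?_⟩
  · unfold nb
    rw [Fintype.mem_piFinset]
    intro i
    rw [mem_ball, dist_eq_norm] at h
    have h1 := PiLp.norm_apply_le (y - x) i
    rw [Real.norm_eq_abs, PiLp.sub_apply] at h1
    have h2 := abs_le.1 (h1.trans h.le)
    have hl : (0:ℝ) < 2 ^ n := by positivity
    rw [Finset.mem_Icc, Pi.sub_apply]
    unfold idx
    have f1 := Int.floor_le (x i / 2 ^ n)
    have f2 := Int.lt_floor_add_one (x i / 2 ^ n)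
    have f3 := Int.floor_le (y i / 2 ^ n)
    have f4 := Int.lt_floor_add_one (y i / 2 ^ n)
    have g1 : y i / 2 ^ n - x i / 2 ^ n ≤ 4 * d := by
      rw [← sub_div, div_le_iff₀ hl]; linarith
    have g2 : -(4 * d) ≤ y i / 2 ^ n - x i / 2 ^ n := by
      rw [← sub_div, le_div_iff₀ hl]; linarith
    constructor
    · have : (-(4 * (d:ℤ) + 1) : ℝ) ≤ ((⌊y i / 2 ^ n⌋ - ⌊x i / 2 ^ n⌋ : ℤ) : ℝ) := by push_cast; linarith
      exact_mod_cast this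
    · have : ((⌊y i / 2 ^ n⌋ - ⌊x i / 2 ^ n⌋ : ℤ) : ℝ) ≤ (4 * (d:ℤ) + 1 : ℝ) := by push_cast; linarith
      exact_mod_cast this
  · rw [add_sub_cancel]; exact mem_idx n y

lemma nbr_sub_ball (hd : 1 ≤ d) {n : ℤ} {x : Sp d} {m : Fin d → ℤ} (hm : m ∈ nb d) :
    dyadCube n (idx n x + m) ⊆ ball x (c1 d * 2 ^ n) := by
  intro z hz
  rw [mem_ball, dist_eq_norm]
  have hl : (0:ℝ) < 2 ^ n := by positivity
  have h : ‖z - x‖ ≤ d * ((4 * d + 2) * 2 ^ n) := by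
    refine norm_le_cube fun i => ?_
    have h1 := hz i
    have h2 := mem_idx n x i
    unfold nb at hm
    rw [Fintype.mem_piFinset] at hm
    have h3 := Finset.mem_Icc.1 (hm i)
    rw [Pi.add_apply] at h1
    push_cast at h1
    have h4 : (-(4 * (d:ℝ) + 1)) ≤ m i := by exact_mod_cast h3.1
    have h5 : (m i : ℝ) ≤ 4 * d + 1 := by exact_mod_cast h3.2
    have h6 := mul_le_mul_of_nonneg_right h4 hl.le
    have h7 := mul_le_mul_of_nonneg_right h5 hl.le
    rw [abs_le]
    constructor <;> linarith
  refine h.trans_lt ?_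
  unfold c1
  have hd0 : (0:ℝ) < d := by exact_mod_cast hd
  have : 0 < (d:ℝ) * 2 ^ n := by positivity
  linarith

lemma cover_step (hd : 1 ≤ d) {E K V : Set (Sp d)} (hE : MeasurableSet E) (hK : IsCompact K)
    (hP : Per E V ≠ ⊤) (n : ℤ) {a : ℝ} (ha : 0 < a) (ha2 : (a * c1 d) ^ d ≤ 1 / 2)
    (hKV : ∀ x ∈ K, ball x (c1 d * 2 ^ n) ⊆ V)
    (hden : ∀ x ∈ K, volume.real (E ∩ ball x (c1 d * 2 ^ n)) ≤ (a * (c1 d * 2 ^ n)) ^ d) :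
    ∃ (s : Finset (Fin d → ℤ)) (c : (Fin d → ℤ) → Sp d), K ⊆ ⋃ k ∈ s, ball (c k) (2 * d * 2 ^ n) ∧
      ∑ k ∈ s, volume.real (E ∩ ball (c k) (2 * (2 * d * 2 ^ n))) ≤
        8 * cP d * (a * (c1 d * 2 ^ n)) * ((nb d).card * (Per E V).toReal) := by
  classical
  have hl : (0:ℝ) < 2 ^ n := by positivity
  have hd0 : (0:ℝ) < d := by exact_mod_cast hd
  have hc1 : 0 < c1 d := by unfold c1; positivity
  set s := (finite_idx hK n).toFinset with hs
  have hch : ∀ k : Fin d → ℤ, ∃ x : Sp d, k ∈ s → x ∈ K ∧ idx n x = k := by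
    intro k
    by_cases hk : k ∈ s
    · obtain ⟨x, hx, h⟩ := (Set.Finite.mem_toFinset _).1 hk
      exact ⟨x, fun _ => ⟨hx, h⟩⟩
    · exact ⟨0, fun h => absurd h hk⟩
  choose c hc using hch
  refine ⟨s, c, ?_, ?_⟩
  · intro x hx
    have hk : idx n x ∈ s := (Set.Finite.mem_toFinset _).2 ⟨x, hx, rfl⟩
    refine mem_iUnion₂.2 ⟨idx n x, hk, ?_⟩
    have h1 := hc _ hk
    rw [mem_ball, dist_eq_norm]
    refine (diam_cCube (dyad_sub_cCube n (idx n x) (mem_dyad_iff.2 h1.2))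
      (dyad_sub_cCube n (idx n x) (mem_idx n x))).trans_lt ?_
    have : 0 < (d:ℝ) * 2 ^ n := by positivity
    linarith
  · have hcube : ∀ k ∈ s, ∀ m ∈ nb d, dyadCube n (k + m) ⊆ ball (c k) (c1 d * 2 ^ n) := by
      intro k hk m hm
      have := nbr_sub_ball hd (n := n) (x := c k) hm
      rwa [(hc k hk).2] at this
    have hoV : ∀ k ∈ s, ∀ m ∈ nb d, oCube n (k + m) ⊆ V := fun k hk m hm =>
      (oCube_sub _ _).trans ((hcube k hk m hm).trans (hKV _ (hc k hk).1))
    have hone : ∀ k ∈ s, ∀ m ∈ nb d, volume.real (E ∩ dyadCube n (k + m)) ≤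
        8 * cP d * (a * (c1 d * 2 ^ n)) * (Per E (oCube n (k + m))).toReal := by
      intro k hk m hm
      have h1 : volume.real (E ∩ dyadCube n (k + m)) ≤ (a * (c1 d * 2 ^ n)) ^ d :=
        (measureReal_mono (inter_subset_inter_right _ (hcube k hk m hm))
          (ne_top_of_le_ne_top measure_ball_lt_top.ne (measure_mono inter_subset_right))).trans
          (hden _ (hc k hk).1)
      refine iso hd hE (by positivity) n _ (ne_top_of_le_ne_top hP (Per_mono hE (hoV k hk m hm))) ?_ h1
      refine h1.trans ?_
      rw [← mul_assoc, mul_pow]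
      have : 0 < ((2:ℝ) ^ n) ^ d := by positivity
      nlinarith
    have hball : ∀ k ∈ s, volume.real (E ∩ ball (c k) (2 * (2 * d * 2 ^ n))) ≤
        ∑ m ∈ nb d, volume.real (E ∩ dyadCube n (k + m)) := by
      intro k hk
      refine le_trans (measureReal_mono (s₂ := ⋃ m ∈ nb d, (E ∩ dyadCube n (k + m))) ?_ ?_)
        (measureReal_biUnion_finset_le _ _)
      · rintro y ⟨hy1, hy2⟩
        obtain ⟨m, hm, hy⟩ := ball_sub_nbr hy2
        rw [(hc k hk).2] at hy
        exact mem_iUnion₂.2 ⟨m, hm, hy1, hy⟩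
      · exact (measure_biUnion_lt_top (Finset.finite_toSet _) fun m _ => (fin_inter_dyad _ _ _).lt_top).ne
    have hcP := cP_nonneg d
    calc _ ≤ ∑ k ∈ s, ∑ m ∈ nb d, 8 * cP d * (a * (c1 d * 2 ^ n)) * (Per E (oCube n (k + m))).toReal :=
          Finset.sum_le_sum fun k hk => (hball k hk).trans (Finset.sum_le_sum fun m hm => hone k hk m hm)
      _ = 8 * cP d * (a * (c1 d * 2 ^ n)) * ∑ m ∈ nb d, ∑ k ∈ s, (Per E (oCube n (k + m))).toReal := by
          rw [Finset.sum_comm, Finset.mul_sum]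
          exact Finset.sum_congr rfl fun m _ => by rw [Finset.mul_sum]
      _ ≤ _ := by
          refine mul_le_mul_of_nonneg_left ?_ (by positivity)
          rw [← nsmul_eq_mul]
          refine Finset.sum_le_card_nsmul _ _ _ fun m hm => ?_
          refine sum_Per_le_real hE s hP (fun k => oCube n (k + m)) (fun k hk => hoV k hk m hm) ?_
          intro k _ k' _ hne
          exact (disj_dyad fun h => hne (add_right_cancel h)).mono (oCube_sub _ _) (oCube_sub _ _)

lemma exists_scale {A B δ : ℝ} (hδ : 0 < δ) : ∃ n : ℤ, A * 2 ^ n < δ ∧ B * 2 ^ n < 1 := by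
  have ht : ∀ A : ℝ, Tendsto (fun j : ℕ => A * (2:ℝ) ^ (-(j:ℤ))) atTop (𝓝 0) := by
    intro A
    rw [← mul_zero A]
    refine Tendsto.const_mul _ ?_
    simp only [zpow_neg, zpow_natCast]
    exact tendsto_inv_atTop_zero.comp (tendsto_pow_atTop_atTop_of_one_lt one_lt_two)
  obtain ⟨j, h1, h2⟩ := (((ht A).eventually_lt_const hδ).and ((ht B).eventually_lt_const one_pos)).exists
  exact ⟨_, h1, h2⟩

lemma Per_sdiff_add {E K V : Set (Sp d)} (hE : MeasurableSet E) (hK : IsCompact K) (hV : IsOpen V) (hKV : K ⊆ V)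
    {ν : ℝ≥0∞} (hν : ∀ U, IsOpen U → K ⊆ U → ν ≤ Per E U) : Per E (V \ K) + ν ≤ Per E V := by
  by_cases hn : Per E V = ⊤
  · rw [hn]; exact le_top
  have hνV := hν V hV hKV
  refine add_le_of_le_tsub_right_of_le hνV ?_
  refine Per_le hE fun φ hφ hnn => ?_
  obtain ⟨U', V', hU', hV', hSU, hKV', hdisj⟩ := SeparatedNhds.of_isCompact_isCompact hφ.cs.isCompact hK
    (disjoint_left.2 fun x hx hxK => (hφ.ts hx).2 hxK)
  refine ENNReal.le_sub_of_add_le_right (ne_top_of_le_ne_top hn hνV) ?_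
  have h1 := le_Per hE (U := U' ∩ V) ⟨hφ.cd, hφ.cs, subset_inter hSU (hφ.ts.trans sdiff_subset)⟩ hnn
  have h2 := hν (V' ∩ V) (hV'.inter hV) (subset_inter hKV' hKV)
  refine (add_le_add h1 h2).trans ((Per_add_le hE ?_).trans (Per_mono hE ?_))
  · exact hdisj.mono inter_subset_left inter_subset_left
  · exact union_subset inter_subset_right inter_subset_right

lemma null_per (d : ℕ) (hd : 1 ≤ d) : ∃ a : ℝ, 0 < a ∧ ∀ E : Set (Sp d), MeasurableSet E →
    HasLocFinitePerimeter E → ∀ K : Set (Sp d), IsCompact K → ∀ δ : ℝ, 0 < δ →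
    (∀ x ∈ K, ∀ r, 0 < r → r < δ → volume.real (E ∩ ball x r) ≤ (a * r) ^ d) →
    ∀ η : ℝ≥0∞, 0 < η → ∃ U, IsOpen U ∧ K ⊆ U ∧ Per E U ≤ η := by
  obtain ⟨Cb, hCb, hcut⟩ := cut_balls d
  have hd0 : (0:ℝ) < d := by exact_mod_cast hd
  have hd1 : (1:ℝ) ≤ d := by exact_mod_cast hd
  have hc1 : 0 < c1 d := by unfold c1; positivity
  have hcP := cP_nonneg d
  set kA := 8 * cP d * c1 d * (nb d).card with hkA
  have hkA0 : 0 ≤ kA := by positivity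
  set a := min (1 / (2 * c1 d)) (1 / (2 * (Cb + 1) * (kA + 1))) with ha
  have ha0 : 0 < a := lt_min (by positivity) (by positivity)
  have ha1 : a * c1 d ≤ 1 / 2 := by
    have := min_le_left (1 / (2 * c1 d)) (1 / (2 * (Cb + 1) * (kA + 1)))
    rw [← ha, le_div_iff₀ (by positivity)] at this
    linarith
  have ha2 : (Cb + 1) * kA * a ≤ 1 / 2 := by
    have := min_le_right (1 / (2 * c1 d)) (1 / (2 * (Cb + 1) * (kA + 1)))
    rw [← ha, le_div_iff₀ (by positivity)] at this
    have : 0 ≤ (Cb + 1) * a := by positivity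
    nlinarith
  have ha3 : (a * c1 d) ^ d ≤ 1 / 2 := (pow_le_of_le_one (by positivity) (by linarith) (by omega)).trans ha1
  refine ⟨a, ha0, fun E hE hloc K hK δ hδ hden η hη => ?_⟩
  by_contra hcon
  push Not at hcon
  set ν : ℝ≥0∞ := ⨅ (U : Set (Sp d)) (_ : IsOpen U) (_ : K ⊆ U), Per E U with hνdef
  have hν : ∀ U, IsOpen U → K ⊆ U → ν ≤ Per E U := fun U h1 h2 =>
    iInf_le_of_le U (iInf_le_of_le h1 (iInf_le_of_le h2 le_rfl))
  have hην : η ≤ ν := le_iInf fun U => le_iInf fun h1 => le_iInf fun h2 => (hcon U h1 h2).le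
  have hν0 : 0 < ν := hη.trans_le hην
  obtain ⟨R, hR⟩ := hK.isBounded.subset_ball (0 : Sp d)
  have hνt : ν ≠ ⊤ := ((hν _ isOpen_ball hR).trans_lt (hloc _ isOpen_ball isBounded_ball)).ne
  have hlt : ν < 2 * ν := by
    rw [two_mul]; exact ENNReal.lt_add_right hνt hν0.ne'
  rw [hνdef, iInf_lt_iff] at hlt
  obtain ⟨V, hlt⟩ := hlt
  rw [iInf_lt_iff] at hlt
  obtain ⟨hV, hlt⟩ := hlt
  rw [iInf_lt_iff] at hlt
  obtain ⟨hKV, hlt⟩ := hlt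
  rw [← hνdef] at hlt
  have hPV : Per E V ≠ ⊤ := hlt.ne_top
  have hPK : Per E (V \ K) ≠ ⊤ := ne_top_of_le_ne_top hPV (Per_mono hE sdiff_subset)
  have e1 := Per_sdiff_add hE hK hV hKV hν
  have e1' : (Per E (V \ K)).toReal + ν.toReal ≤ (Per E V).toReal := by
    rw [← ENNReal.toReal_add hPK hνt]; exact ENNReal.toReal_mono hPV e1
  have e2' : (Per E V).toReal < 2 * ν.toReal := by
    have := (ENNReal.toReal_lt_toReal hPV (by finiteness)).2 hlt
    simpa using this
  have e3 : Per E V ≤ ENNReal.ofReal ((Per E (V \ K)).toReal + 1 / 2 * (Per E V).toReal) := by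
    refine Per_le hE fun φ hφ hn => ENNReal.ofReal_le_ofReal ?_
    obtain ⟨M, hM0, hM⟩ := divg_bound hφ.cd hφ.cs
    obtain ⟨δ', hδ', hthick⟩ := hK.exists_thickening_subset_open hV hKV
    obtain ⟨n, hn1, hn2⟩ := exists_scale (A := c1 d) (B := M) (lt_min hδ hδ')
    have hl : (0:ℝ) < 2 ^ n := by positivity
    obtain ⟨s, c, hcov, hsum⟩ := cover_step hd hE hK hPV n ha0 ha3
      (fun x hx => (ball_subset_ball (hn1.le.trans (min_le_right _ _))).trans
        ((ball_subset_thickening hx _).trans hthick))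
      (fun x hx => hden x hx _ (by positivity) (hn1.trans_le (min_le_left _ _)))
    have h := hcut E (V \ K) hE hPK φ hφ.cd hφ.cs hn M hM0 hM s c (fun _ => 2 * d * 2 ^ n)
      (fun _ _ => by positivity) (by
        intro x hx
        by_cases hxK : x ∈ K
        · exact Or.inr (hcov hxK)
        · exact Or.inl ⟨hφ.ts hx, hxK⟩)
    rw [← Finset.mul_sum] at h
    refine h.trans ?_
    refine add_le_add le_rfl ?_
    set P := (Per E V).toReal
    have hP0 : 0 ≤ P := ENNReal.toReal_nonneg
    calc _ ≤ (Cb / (2 * d * 2 ^ n) + M) * (8 * cP d * (a * (c1 d * 2 ^ n)) * ((nb d).card * P)) := mul_le_mul_of_nonneg_left hsum (by positivity)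
      _ = (Cb / (2 * d) + M * 2 ^ n) * (kA * a * P) := by rw [hkA]; field_simp
      _ ≤ (Cb + 1) * (kA * a * P) := by
          gcongr
          exact div_le_self hCb (by linarith)
      _ = (Cb + 1) * kA * a * P := by ring
      _ ≤ _ := mul_le_mul_of_nonneg_right ha2 hP0
  have e3' : (Per E V).toReal ≤ (Per E (V \ K)).toReal + 1 / 2 * (Per E V).toReal :=
    ENNReal.toReal_le_of_le_ofReal (by positivity) e3
  linarith

end DM

namespace DM
open scoped Topology
variable {d : ℕ}

lemma dens_of_notMem {E : Set (Sp d)} {x : Sp d} (hx : x ∉ mClos E) {a : ℝ} (ha : 0 < a) :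
    ∃ δ > 0, ∀ r, 0 < r → r < δ → volume.real (E ∩ ball x r) ≤ (a * r) ^ d := by
  have h0 : ¬ (0 < Filter.limsup
      (fun r : ℝ => volume (Metric.ball x r ∩ E) / ENNReal.ofReal (r ^ d))
      (nhdsWithin 0 (Set.Ioi 0))) := hx
  have h1 : Filter.limsup
      (fun r : ℝ => volume (Metric.ball x r ∩ E) / ENNReal.ofReal (r ^ d))
      (nhdsWithin 0 (Set.Ioi 0)) < ENNReal.ofReal (a ^ d) :=
    (not_lt.1 h0).trans_lt (ENNReal.ofReal_pos.2 (by positivity))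
  have h2 := Filter.eventually_lt_of_limsup_lt h1
  rw [eventually_nhdsWithin_iff, Metric.eventually_nhds_iff] at h2
  obtain ⟨δ, hδ, h⟩ := h2
  refine ⟨δ, hδ, fun r hr hrδ => ?_⟩
  have h3 := h (y := r) (by rw [Real.dist_eq, sub_zero, abs_of_pos hr]; exact hrδ) hr
  have hp : 0 < r ^ d := by positivity
  rw [ENNReal.div_lt_iff (Or.inl (ENNReal.ofReal_pos.2 hp).ne') (Or.inl ENNReal.ofReal_ne_top),
    ← ENNReal.ofReal_mul (by positivity), inter_comm, ← mul_pow] at h3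
  exact ENNReal.toReal_le_of_le_ofReal (by positivity) h3.le

lemma small_open0 (hd : 1 ≤ d) {E : Set (Sp d)} (hE : MeasurableSet E) (hl : HasLocFinitePerimeter E)
    {η : ℝ≥0∞} (hη : 0 < η) : ∃ G, IsOpen G ∧ (mClos E)ᶜ ⊆ G ∧ Per E G ≤ η := by
  obtain ⟨a, ha, hnull⟩ := null_per d hd
  set A : ℕ → Set (Sp d) := fun j => {x | x ∈ closedBall (0 : Sp d) j ∧
    ∀ r : ℝ, 0 < r → r < 1 / (j + 1) → volume.real (E ∩ ball x r) ≤ (a / 2 * r) ^ d} with hA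
  have hcomp : ∀ j, IsCompact (closure (A j)) := fun j =>
    (isCompact_closedBall (0 : Sp d) j).closure_of_subset fun x hx => hx.1
  obtain ⟨ε, hε, hsum⟩ := ENNReal.exists_pos_sum_of_countable hη.ne' ℕ
  have hU : ∀ j, ∃ U, IsOpen U ∧ closure (A j) ⊆ U ∧ Per E U ≤ ε j := by
    intro j
    have hj : (0:ℝ) < 1 / (j + 1) := by positivity
    refine hnull E hE hl _ (hcomp j) (1 / (j + 1) / 2) (by positivity) ?_ _ (by exact_mod_cast hε j)
    intro x hx r hr hr2
    obtain ⟨y, hy, hxy⟩ := Metric.mem_closure_iff.1 hx r hr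
    have h1 := hy.2 (2 * r) (by positivity) (by linarith)
    have h2 : volume.real (E ∩ ball x r) ≤ volume.real (E ∩ ball y (2 * r)) :=
      measureReal_mono (inter_subset_inter_right _ (ball_subset_ball' (by linarith)))
        (ne_top_of_le_ne_top measure_ball_lt_top.ne (measure_mono inter_subset_right))
    refine h2.trans (h1.trans (le_of_eq ?_))
    congr 1; ring
  choose U hUo hUs hUP using hU
  refine ⟨⋃ j, U j, isOpen_iUnion hUo, ?_, ?_⟩
  · intro x hx
    obtain ⟨δ, hδ, h⟩ := dens_of_notMem hx (half_pos ha)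
    obtain ⟨j1, hj1⟩ := exists_nat_ge ‖x‖
    obtain ⟨j2, hj2⟩ := exists_nat_one_div_lt hδ
    refine mem_iUnion.2 ⟨max j1 j2, hUs _ (subset_closure ⟨?_, fun r hr hr2 => h r hr (hr2.trans ?_)⟩)⟩
    · rw [mem_closedBall_zero_iff]
      exact hj1.trans (by exact_mod_cast le_max_left _ _)
    · refine lt_of_le_of_lt ?_ hj2
      have : (j2 : ℝ) ≤ (max j1 j2 : ℕ) := by exact_mod_cast le_max_right _ _
      gcongr
  · exact (Per_iUnion_le hE hUo).trans ((ENNReal.tsum_le_tsum hUP).trans hsum.le)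

lemma small_open (hd : 1 ≤ d) {E : Set (Sp d)} (hE : MeasurableSet E) (hl : HasLocFinitePerimeter E)
    {η : ℝ≥0∞} (hη : 0 < η) : ∃ G, IsOpen G ∧ (mBdry E)ᶜ ⊆ G ∧ Per E G ≤ η := by
  obtain ⟨G, hG, hGs, hGP⟩ := small_open0 hd hE hl (ENNReal.half_pos hη.ne')
  have hl' : HasLocFinitePerimeter Eᶜ := fun U hU hb => by
    have : Per Eᶜ U < ⊤ := by rw [Per_compl hE]; exact hl U hU hb
    exact this
  obtain ⟨G', hG', hGs', hGP'⟩ := small_open0 hd hE.compl hl' (ENNReal.half_pos hη.ne')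
  rw [Per_compl hE] at hGP'
  refine ⟨G ∪ G', hG.union hG', ?_, ?_⟩
  · unfold mBdry
    rw [compl_inter]
    exact union_subset_union hGs hGs'
  · refine (Per_union_le hE hG hG').trans ((add_le_add hGP hGP').trans (ENNReal.add_halves η).le)

lemma hcover {A : Set (Sp d)} {m : ℕ} (hA : μH[(m:ℝ)] A ≠ ⊤) {ρ η : ℝ} (hρ : 0 < ρ) (hη : 0 < η) :
    ∃ (ι : Type) (c : ι → Sp d) (r : ι → ℝ), (∀ i, 0 < r i) ∧ (∀ i, r i < ρ) ∧
      A ⊆ (⋃ i, ball (c i) (r i)) ∧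
      ∀ s : Finset ι, ∑ i ∈ s, r i ^ m ≤ (μH[(m:ℝ)] A).toReal + 2 * η := by
  have h1 : (⨅ (t : ℕ → Set (Sp d)) (_ : A ⊆ ⋃ n, t n) (_ : ∀ n, ediam (t n) ≤ ENNReal.ofReal (ρ / 2)),
          ∑' n, ⨆ _ : (t n).Nonempty, ediam (t n) ^ (m:ℝ)) < μH[(m:ℝ)] A + ENNReal.ofReal η := by
    refine lt_of_le_of_lt ?_ (ENNReal.lt_add_right hA (ENNReal.ofReal_pos.2 hη).ne')
    rw [Measure.hausdorffMeasure_apply]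
    exact le_iSup₂_of_le (ENNReal.ofReal (ρ / 2)) (ENNReal.ofReal_pos.2 (by positivity)) le_rfl
  simp only [iInf_lt_iff] at h1
  obtain ⟨t, hAt, htd, hts⟩ := h1
  obtain ⟨ε, hε, hsum⟩ := ENNReal.exists_pos_sum_of_countable (ENNReal.ofReal_pos.2 hη).ne' ℕ
  have hr : ∀ i : {n // (t n).Nonempty}, ∃ r : ℝ, (ediam (t i)).toReal < r ∧ r < ρ ∧
      r ^ m < (ediam (t i)).toReal ^ m + ε i := by
    intro i
    set D := (ediam (t i)).toReal
    have hD : D < ρ := by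
      have : D ≤ ρ / 2 := ENNReal.toReal_le_of_le_ofReal (by positivity) (htd i)
      linarith
    have hc : ∀ᶠ r in 𝓝[>] D, r ^ m < D ^ m + ε i := by
      have : ContinuousAt (fun r : ℝ => r ^ m) D := by fun_prop
      exact (this.eventually_lt_const (lt_add_of_pos_right _ (by exact_mod_cast hε i))).filter_mono
        nhdsWithin_le_nhds
    obtain ⟨r, ⟨h1, h2⟩, h3⟩ := ((hc.and ((eventually_lt_nhds hD).filter_mono nhdsWithin_le_nhds)).and
      self_mem_nhdsWithin).exists
    exact ⟨r, h3, h2, h1⟩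
  choose r hr1 hr2 hr3 using hr
  have hfin : ∀ n, ediam (t n) ≠ ⊤ := fun n => ne_top_of_le_ne_top ENNReal.ofReal_ne_top (htd n)
  have hr0 : ∀ i, 0 < r i := fun i => ENNReal.toReal_nonneg.trans_lt (hr1 i)
  refine ⟨{n // (t n).Nonempty}, fun i => i.2.some, r, hr0, hr2, ?_, ?_⟩
  · intro x hx
    obtain ⟨n, hn⟩ := mem_iUnion.1 (hAt hx)
    refine mem_iUnion.2 ⟨⟨n, ⟨x, hn⟩⟩, ?_⟩
    rw [mem_ball]
    refine lt_of_le_of_lt ?_ (hr1 ⟨n, ⟨x, hn⟩⟩)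
    rw [dist_edist]
    exact ENNReal.toReal_mono (hfin n) (edist_le_ediam_of_mem hn (Set.Nonempty.some_mem _))
  · intro s
    have h2 : ∀ i : {n // (t n).Nonempty}, ENNReal.ofReal (r i ^ m) ≤
        (⨆ _ : (t i).Nonempty, ediam (t i) ^ (m:ℝ)) + ε i := by
      intro i
      refine (ENNReal.ofReal_le_ofReal (hr3 i).le).trans ?_
      rw [ENNReal.ofReal_add (by positivity) (by positivity), ENNReal.ofReal_coe_nnreal,
        ENNReal.ofReal_pow ENNReal.toReal_nonneg, ENNReal.ofReal_toReal (hfin i), ENNReal.rpow_natCast]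
      refine add_le_add ?_ le_rfl
      exact le_iSup_of_le i.2 le_rfl
    have h3 : ENNReal.ofReal (∑ i ∈ s, r i ^ m) ≤ ENNReal.ofReal ((μH[(m:ℝ)] A).toReal + 2 * η) := by
      rw [ENNReal.ofReal_sum_of_nonneg fun i _ => pow_nonneg (hr0 i).le _]
      calc _ ≤ ∑ i ∈ s, ((⨆ _ : (t i).Nonempty, ediam (t i) ^ (m:ℝ)) + (ε i : ℝ≥0∞)) :=
            Finset.sum_le_sum fun i _ => h2 i
        _ ≤ ∑' i : {n // (t n).Nonempty}, ((⨆ _ : (t i).Nonempty, ediam (t i) ^ (m:ℝ)) + (ε i : ℝ≥0∞)) :=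
            ENNReal.sum_le_tsum s
        _ ≤ ∑' n : ℕ, ((⨆ _ : (t n).Nonempty, ediam (t n) ^ (m:ℝ)) + (ε n : ℝ≥0∞)) :=
            ENNReal.tsum_comp_le_tsum_of_injective (f := ((↑) : {n // (t n).Nonempty} → ℕ)) Subtype.val_injective
              (fun n => (⨆ _ : (t n).Nonempty, ediam (t n) ^ (m:ℝ)) + (ε n : ℝ≥0∞))
        _ ≤ (μH[(m:ℝ)] A + ENNReal.ofReal η) + ENNReal.ofReal η := by
            rw [ENNReal.tsum_add]; exact add_le_add hts.le hsum.le
        _ = _ := by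
            rw [two_mul, ← add_assoc, ENNReal.ofReal_add (by positivity) hη.le,
              ENNReal.ofReal_add (by positivity) hη.le, ENNReal.ofReal_toReal hA]
    exact (ENNReal.ofReal_le_ofReal_iff (by positivity)).1 h3

lemma partB (d : ℕ) (hd : 1 ≤ d) : ∃ C : ℝ, 0 < C ∧ ∀ Ω E : Set (Sp d), IsOpen Ω → MeasurableSet E →
    HasLocFinitePerimeter E → Per E Ω ≤ ENNReal.ofReal C * μH[(d:ℝ) - 1] (mBdry E ∩ Ω) := by
  obtain ⟨Cb, hCb, hcut⟩ := cut_balls d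
  obtain ⟨m, rfl⟩ : ∃ m, d = m + 1 := ⟨d - 1, by omega⟩
  set v := volume.real (ball (0 : Sp (m + 1)) 1) with hv
  have hv0 : 0 < v := ENNReal.toReal_pos (measure_ball_pos _ _ one_pos).ne' measure_ball_lt_top.ne
  set C := (Cb + 1) * 2 ^ (m + 1) * v with hC
  have hC0 : 0 < C := by positivity
  refine ⟨C, hC0, fun Ω E hΩ hE hl => ?_⟩
  have hm : ((m + 1 : ℕ) : ℝ) - 1 = m := by push_cast; ring
  rw [hm]
  set A := mBdry E ∩ Ω
  by_cases hA : μH[(m:ℝ)] A = ⊤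
  · rw [hA, ENNReal.mul_top (ENNReal.ofReal_pos.2 hC0).ne']; exact le_top
  rw [← ENNReal.ofReal_toReal hA, ← ENNReal.ofReal_mul hC0.le]
  set H := (μH[(m:ℝ)] A).toReal
  refine Per_le hE fun φ hφ hn => ENNReal.ofReal_le_ofReal ?_
  obtain ⟨M, hM0, hM⟩ := divg_bound hφ.cd hφ.cs
  have key : ∀ η : ℝ, 0 < η → ∫ x in E, divg φ x ≤ η + C * (H + 2 * η) := by
    intro η hη
    obtain ⟨G, hG, hGs, hGP⟩ := small_open hd hE hl (ENNReal.ofReal_pos.2 hη)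
    obtain ⟨ι, c, r, hr0, hrρ, hcov, hsum⟩ := hcover hA (ρ := 1 / (M + 1)) (by positivity) hη
    have hcov' : tsupport φ ⊆ ⋃ o : Option ι, (match o with
        | none => G
        | some i => ball (c i) (r i)) := by
      intro x hx
      by_cases hxG : x ∈ G
      · exact mem_iUnion.2 ⟨none, hxG⟩
      · have : x ∈ mBdry E := by by_contra h; exact hxG (hGs h)
        obtain ⟨i, hi⟩ := mem_iUnion.1 (hcov ⟨this, hφ.ts hx⟩)
        exact mem_iUnion.2 ⟨some i, hi⟩
    obtain ⟨t, ht⟩ := hφ.cs.isCompact.elim_finite_subcover _ (by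
      rintro (_ | i)
      · exact hG
      · exact isOpen_ball) hcov'
    have h := hcut E G hE (ne_top_of_le_ne_top ENNReal.ofReal_ne_top hGP) φ hφ.cd hφ.cs hn M hM0 hM
      t.eraseNone c r (fun i _ => hr0 i) (by
        intro x hx
        obtain ⟨o, ho, hxo⟩ := mem_iUnion₂.1 (ht hx)
        rcases o with _ | i
        · exact Or.inl hxo
        · exact Or.inr (mem_iUnion₂.2 ⟨i, Finset.mem_eraseNone.2 ho, hxo⟩))
    refine h.trans (add_le_add (ENNReal.toReal_le_of_le_ofReal hη.le hGP) ?_)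
    calc _ ≤ ∑ i ∈ t.eraseNone, C * r i ^ m := by
          refine Finset.sum_le_sum fun i _ => ?_
          have hri := hr0 i
          have hv2 : volume.real (E ∩ ball (c i) (2 * r i)) ≤ (2 * r i) ^ (m + 1) * v := by
            refine (measureReal_mono inter_subset_right measure_ball_lt_top.ne).trans (le_of_eq ?_)
            rw [measureReal_def, Measure.addHaar_ball _ _ (by positivity), ENNReal.toReal_mul,
              ENNReal.toReal_ofReal (by positivity), finrank_euclideanSpace, Fintype.card_fin]
            rfl
          have hMr : M * r i ≤ 1 := by
            have := (lt_div_iff₀ (by positivity)).1 (hrρ i)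
            nlinarith
          calc _ ≤ (Cb / r i + M) * ((2 * r i) ^ (m + 1) * v) :=
                mul_le_mul_of_nonneg_left hv2 (by positivity)
            _ = (Cb + M * r i) * (2 ^ (m + 1) * v * r i ^ m) := by
                rw [mul_pow, pow_succ (r i)]; field_simp
            _ ≤ (Cb + 1) * (2 ^ (m + 1) * v * r i ^ m) :=
                mul_le_mul_of_nonneg_right (by linarith) (by positivity)
            _ = _ := by rw [hC]; ring
      _ = C * ∑ i ∈ t.eraseNone, r i ^ m := by rw [Finset.mul_sum]
      _ ≤ _ := mul_le_mul_of_nonneg_left (hsum _) hC0.le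
  refine le_of_forall_pos_le_add fun e he => ?_
  have h := key (e / (1 + 2 * C)) (by positivity)
  refine h.trans (le_of_eq ?_)
  field_simp
  ring

theorem final (d : ℕ) (hd : 1 ≤ d) :
    ∃ Cd : ℝ≥0∞, Cd ≠ ⊤ ∧
      (∀ (Ω E : Set (EuclideanSpace ℝ (Fin d))), IsOpen Ω → MeasurableSet E →
        HasLocFinitePerimeter E →
        var Ω (fun x => (dyadMax Ω E x).toReal)
          ≤ Cd * μH[(d : ℝ) - 1] (mBdry E ∩ Ω)) ∧
      (∀ E : Set (EuclideanSpace ℝ (Fin d)), MeasurableSet E →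
        HasLocFinitePerimeter E →
        var Set.univ (fun x => (dyadMax Set.univ E x).toReal)
          ≤ Cd * var Set.univ (E.indicator fun _ => (1 : ℝ))) := by
  obtain ⟨C, hC, hB⟩ := partB d hd
  refine ⟨ENNReal.ofReal (1 + cT d * d) * ENNReal.ofReal C + ENNReal.ofReal (1 + cT d * d), by finiteness, ?_, ?_⟩
  · intro Ω E hΩ hE hl
    refine (partA hd hE hΩ).trans ((mul_le_mul_right (hB Ω E hΩ hE hl) _).trans ?_)
    rw [← mul_assoc]
    exact mul_le_mul_left (le_add_of_nonneg_right (zero_le)) _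
  · intro E hE hl
    exact (partA hd hE isOpen_univ).trans (mul_le_mul_left (le_add_of_nonneg_left (zero_le)) _)

end DM

/-- variation bound for the local dyadic maximal function; in particular
on `Ω = ℝ^d` the variation of `M1_E` is bounded by the variation of `1_E`. -/
theorem stmt14 (d : ℕ) (hd : 1 ≤ d) :
    ∃ Cd : ℝ≥0∞, Cd ≠ ⊤ ∧
      (∀ (Ω E : Set (EuclideanSpace ℝ (Fin d))), IsOpen Ω → MeasurableSet E →
        HasLocFinitePerimeter E →
        var Ω (fun x => (dyadMax Ω E x).toReal)
          ≤ Cd * μH[(d : ℝ) - 1] (mBdry E ∩ Ω)) ∧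
      (∀ E : Set (EuclideanSpace ℝ (Fin d)), MeasurableSet E →
        HasLocFinitePerimeter E →
        var Set.univ (fun x => (dyadMax Set.univ E x).toReal)
          ≤ Cd * var Set.univ (E.indicator fun _ => (1 : ℝ))) := by
  exact DM.final d hd
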